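/- Let 1<p≤q<∞, set 1/s := 1/p + 1/q', and let w ∈ A_q. Let 𝒟 be a dyadic lattice and 𝒮 ⊆ 𝒟 a γ-sparse collection. Then the operator f ↦ Σ_{Q∈𝒮} ( |Q|^{−s} ∫_Q |f|^s dx )^{1/s} 1_Q is bounded from L^p(w^{p/q}) to L^q(w) with norm ≲ [w]_{A_q}^{max(1/p'+1/q, 1/(q−1))}. -/

import Mathlib

open MeasureTheory ENNReal Set Filter

noncomputable section

/-- `ℝ^d` with the Euclidean structure. -/
abbrev Rd (d : ℕ) := EuclideanSpace ℝ (Fin d)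

variable {d : ℕ}

/-- An axis-parallel cube in `ℝ^d`, given by a corner and a (positive) side length. -/
structure Cube (d : ℕ) where
  corner : Fin d → ℝ
  side : ℝ
  side_pos : 0 < side

namespace Cube

/-- The set of points of the cube. -/
def carrier (Q : Cube d) : Set (Rd d) :=
  {x | ∀ i, Q.corner i ≤ x i ∧ x i < Q.corner i + Q.side}

/-- The volume `|Q| = ℓ(Q)^d` of the cube. -/
def vol (Q : Cube d) : ℝ := Q.side ^ d

/-- The concentric cube with twice the side length. -/
def double (Q : Cube d) : Cube d :=
  ⟨fun i => Q.corner i - Q.side / 2, 2 * Q.side, by have := Q.side_pos; linarith⟩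

end Cube

/-- `∫_Q f`. -/
def intC (Q : Cube d) (f : Rd d → ℝ) : ℝ := ∫ x in Q.carrier, f x

/-- `w(Q) = ∫_Q w`. -/
def wInt (Q : Cube d) (w : Rd d → ℝ) : ℝ := intC Q w

/-- The average `⟨f⟩_Q = |Q|⁻¹ ∫_Q f`. -/
def avg (Q : Cube d) (f : Rd d → ℝ) : ℝ := Q.vol⁻¹ * intC Q f

/-- The mean oscillation `∫_Q |f - ⟨f⟩_Q|`. -/
def osc (Q : Cube d) (b : Rd d → ℝ) : ℝ := ∫ x in Q.carrier, |b x - avg Q b|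

/-- The conjugate (dual) exponent `p' = p/(p-1)`. -/
def conj (p : ℝ) : ℝ := p / (p - 1)

/-- The weighted Lebesgue norm `‖f‖_{L^p(w)} = (∫ |f|^p w dx)^{1/p}`. -/
def wnorm (p : ℝ) (w : Rd d → ℝ) (f : Rd d → ℝ) : ℝ≥0∞ :=
  (∫⁻ x, ENNReal.ofReal (|f x| ^ p * w x)) ^ (1 / p)

/-- The weighted Lebesgue norm of an `ℝ≥0∞`-valued function. -/
def wnormE (p : ℝ) (w : Rd d → ℝ) (f : Rd d → ℝ≥0∞) : ℝ≥0∞ :=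
  (∫⁻ x, f x ^ p * ENNReal.ofReal (w x)) ^ (1 / p)

/-- A weight: a positive, measurable, locally integrable function. -/
def IsWeight (w : Rd d → ℝ) : Prop :=
  (∀ x, 0 < w x) ∧ Measurable w ∧ LocallyIntegrable w volume

/-- `b ∈ L¹_loc`. -/
def L1loc (b : Rd d → ℝ) : Prop := Measurable b ∧ LocallyIntegrable b volume

/-- Bounded measurable functions with compact support (the class `L^∞_c`). -/
def BddCompactSupp (f : Rd d → ℝ) : Prop :=
  Measurable f ∧ HasCompactSupport f ∧ ∃ M : ℝ, ∀ x, |f x| ≤ M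

/-- `‖U‖_{L^p(μ) → L^q(λ)} ≤ N`, tested on all measurable functions. -/
def OpBound (p q : ℝ) (μ lam : Rd d → ℝ) (U : (Rd d → ℝ) → Rd d → ℝ) (N : ℝ) : Prop :=
  ∀ f : Rd d → ℝ, Measurable f → wnorm q lam (U f) ≤ ENNReal.ofReal N * wnorm p μ f

/-- `‖U‖_{L^p(μ) → L^q(λ)} ≤ N`, tested on the dense class `L^∞_c`. -/
def OpBoundCS (p q : ℝ) (μ lam : Rd d → ℝ) (U : (Rd d → ℝ) → Rd d → ℝ) (N : ℝ) : Prop :=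
  ∀ f : Rd d → ℝ, BddCompactSupp f → wnorm q lam (U f) ≤ ENNReal.ofReal N * wnorm p μ f

/-- The weighted sharp maximal function, with cubes restricted to the family `𝒟`. -/
def sharpMaxOn (𝒟 : Set (Cube d)) (ν b : Rd d → ℝ) (x : Rd d) : ℝ≥0∞ :=
  ⨆ (Q : Cube d) (_ : Q ∈ 𝒟) (_ : x ∈ Q.carrier), ENNReal.ofReal (osc Q b / wInt Q ν)

/-- `‖M^♯_ν b‖_{L^r(ν)}`. -/
def sharpNormOn (𝒟 : Set (Cube d)) (r : ℝ) (ν b : Rd d → ℝ) : ℝ≥0∞ :=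
  wnormE r ν (sharpMaxOn 𝒟 ν b)

/-- `‖b‖_{BMO_ν^α} = sup_Q ν(Q)^{-e} ∫_Q |b - ⟨b⟩_Q|` with `e = 1 + α/d`. -/
def bmoNormOn (𝒟 : Set (Cube d)) (e : ℝ) (ν b : Rd d → ℝ) : ℝ≥0∞ :=
  ⨆ (Q : Cube d) (_ : Q ∈ 𝒟), ENNReal.ofReal (osc Q b / wInt Q ν ^ e)

/-- The Muckenhoupt `A_p` characteristic over the family `𝒟`. -/
def ApCharOn (𝒟 : Set (Cube d)) (p : ℝ) (w : Rd d → ℝ) : ℝ≥0∞ :=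
  ⨆ (Q : Cube d) (_ : Q ∈ 𝒟),
    ENNReal.ofReal (avg Q w * avg Q (fun x => w x ^ (-(conj p / p))) ^ (p / conj p))

/-- `w ∈ A_p` (over the family `𝒟`). -/
def IsApOn (𝒟 : Set (Cube d)) (p : ℝ) (w : Rd d → ℝ) : Prop :=
  IsWeight w ∧ LocallyIntegrable (fun x => w x ^ (-(conj p / p))) volume ∧
    ApCharOn 𝒟 p w < ⊤

/-- The Fujii–Wilson `A_∞` characteristic over the family `𝒟`. -/
def AinfCharOn (𝒟 : Set (Cube d)) (w : Rd d → ℝ) : ℝ≥0∞ :=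
  ⨆ (Q : Cube d) (_ : Q ∈ 𝒟),
    (∫⁻ x in Q.carrier,
        ⨆ (R : Cube d) (_ : R ∈ 𝒟) (_ : x ∈ R.carrier),
          ENNReal.ofReal ((∫ y in Q.carrier ∩ R.carrier, w y) / R.vol)) /
      ENNReal.ofReal (wInt Q w)

/-- The relative Fujii–Wilson characteristic `[w]_{A_∞(ν)}` over the family `𝒟`. -/
def relAinfOn (𝒟 : Set (Cube d)) (w ν : Rd d → ℝ) : ℝ≥0∞ :=
  ⨆ (Q : Cube d) (_ : Q ∈ 𝒟),
    (∫⁻ x in Q.carrier,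
        (⨆ (R : Cube d) (_ : R ∈ 𝒟) (_ : R.carrier ⊆ Q.carrier) (_ : x ∈ R.carrier),
          ENNReal.ofReal (wInt R w / wInt R ν)) * ENNReal.ofReal (ν x)) /
      ENNReal.ofReal (wInt Q w)

/-- The joint Bloom–Muckenhoupt characteristic `[μ',λ,ν]_{B_{p',q}}` (for upper bounds). -/
def BupperOn (𝒟 : Set (Cube d)) (p q : ℝ) (μ' lam ν : Rd d → ℝ) : ℝ≥0∞ :=
  ⨆ (Q : Cube d) (_ : Q ∈ 𝒟),
    ENNReal.ofReal (avg Q μ' ^ (1 / conj p) * avg Q lam ^ (1 / q) *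
      avg Q ν ^ (1 / p + 1 / conj q))

/-- The joint Bloom–Muckenhoupt characteristic `[μ,λ']_{B_{p,q'}(ν)}` (for lower bounds). -/
def BlowerOn (𝒟 : Set (Cube d)) (p q : ℝ) (μ lam' ν : Rd d → ℝ) : ℝ≥0∞ :=
  ⨆ (Q : Cube d) (_ : Q ∈ 𝒟),
    ENNReal.ofReal ((wInt Q μ / wInt Q ν) ^ (1 / p) * (wInt Q lam' / wInt Q ν) ^ (1 / conj q))

/-- A doubling weight. -/
def DoublingWeight (w : Rd d → ℝ) : Prop :=
  ∃ C : ℝ, 0 < C ∧ ∀ Q : Cube d, wInt Q.double w ≤ C * wInt Q w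

/-- A `(γ, ν)`-sparse collection of cubes (with respect to a weight `ν`). -/
def SparseFamily (γ : ℝ) (ν : Rd d → ℝ) (S : Set (Cube d)) : Prop :=
  ∃ E : Cube d → Set (Rd d),
    (∀ Q ∈ S, E Q ⊆ Q.carrier ∧ MeasurableSet (E Q) ∧ γ * wInt Q ν ≤ ∫ x in E Q, ν x) ∧
    S.Pairwise fun Q R => Disjoint (E Q) (E R)

/-- A `(γ, ν)`-sparse collection of cubes (with respect to a measure `ν`). -/
def MSparseFamily (γ : ℝ) (ν : Measure (Rd d)) (S : Set (Cube d)) : Prop :=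
  ∃ E : Cube d → Set (Rd d),
    (∀ Q ∈ S, E Q ⊆ Q.carrier ∧ ENNReal.ofReal γ * ν Q.carrier ≤ ν (E Q)) ∧
    S.Pairwise fun Q R => Disjoint (E Q) (E R)

/-- The weighted sharp maximal function with respect to a measure `ν`. -/
def mSharpMaxOn (𝒟 : Set (Cube d)) (ν : Measure (Rd d)) (b : Rd d → ℝ) (x : Rd d) : ℝ≥0∞ :=
  ⨆ (Q : Cube d) (_ : Q ∈ 𝒟) (_ : x ∈ Q.carrier), ENNReal.ofReal (osc Q b) / ν Q.carrier

/-- The distance between two sets in `ℝ^d`. -/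
def setDist (s t : Set (Rd d)) : ℝ := sInf {r | ∃ x ∈ s, ∃ y ∈ t, r = dist x y}

/-- Supports separated by a positive distance. -/
def SeparatedSupports (f g : Rd d → ℝ) : Prop :=
  ∃ ε : ℝ, 0 < ε ∧ ∀ x ∈ tsupport f, ∀ y ∈ tsupport g, ε ≤ dist x y

/-- A dyadic lattice on `ℝ^d`: for every `k ∈ ℤ` a partition of `ℝ^d` into cubes of
side length `2^{-k}`, each refining the previous one. -/
structure DyadicLattice (d : ℕ) where
  layer : ℤ → Set (Cube d)
  side_eq : ∀ k : ℤ, ∀ Q ∈ layer k, Q.side = (2 : ℝ) ^ (-k)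
  covers : ∀ k : ℤ, ∀ x : Rd d, ∃ Q ∈ layer k, x ∈ Q.carrier
  pairwiseDisjoint : ∀ k : ℤ, ∀ Q ∈ layer k, ∀ R ∈ layer k,
    Q ≠ R → Q.carrier ∩ R.carrier = ∅
  refines : ∀ k : ℤ, ∀ Q ∈ layer (k + 1), ∃ R ∈ layer k, Q.carrier ⊆ R.carrier

/-- The cubes of a dyadic lattice. -/
def DyadicLattice.cubes (D : DyadicLattice d) : Set (Cube d) := {Q | ∃ k, Q ∈ D.layer k}

/-- `𝒟(Q₀)`: the dyadic cubes contained in `Q₀`. -/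
def DyadicLattice.below (D : DyadicLattice d) (Q₀ : Cube d) : Set (Cube d) :=
  {Q ∈ D.cubes | Q.carrier ⊆ Q₀.carrier}

open Classical in
/-- The martingale difference `D_Q b = Σ_{R : R̂ = Q} ⟨b⟩_R 1_R − ⟨b⟩_Q 1_Q`. -/
def DyadicLattice.DQ (D : DyadicLattice d) (Q : Cube d) (b : Rd d → ℝ) (x : Rd d) : ℝ :=
  if h : x ∈ Q.carrier ∧
      ∃ R, R ∈ D.cubes ∧ R.side = Q.side / 2 ∧ x ∈ R.carrier ∧ R.carrier ⊆ Q.carrier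
  then avg h.2.choose b - avg Q b
  else 0

/-- Finite partial sums `Σ_{Q ∈ F} D_Q b ⟨f⟩_Q` of the paraproduct. -/
def parasum (D : DyadicLattice d) (b f : Rd d → ℝ) (F : Finset (Cube d)) (x : Rd d) : ℝ :=
  ∑ Q ∈ F, D.DQ Q b x * avg Q f

/-- Unconditional convergence of the paraproduct sum in `L¹_loc` to the function `S`. -/
def UncondConvL1loc (D : DyadicLattice d) (b f S : Rd d → ℝ) : Prop :=
  ∀ K : Set (Rd d), IsCompact K → ∀ ε : ℝ, 0 < ε →
    ∃ F₀ : Finset (Cube d), ↑F₀ ⊆ D.cubes ∧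
      ∀ F : Finset (Cube d), ↑F ⊆ D.cubes → F₀ ⊆ F →
        ∫ x in K, |parasum D b f F x - S x| < ε

/-- `P` is the dyadic paraproduct `Π_b` associated to `b` and the lattice `D`. -/
def IsParaproduct (D : DyadicLattice d) (b : Rd d → ℝ) (P : (Rd d → ℝ) → Rd d → ℝ) : Prop :=
  ∀ f : Rd d → ℝ, BddCompactSupp f → UncondConvL1loc D b f (P f)

/-- Unconditional convergence of the paraproduct sum in `L^q(λ)` to the function `S`. -/
def UncondConvLq (D : DyadicLattice d) (q : ℝ) (lam : Rd d → ℝ) (b f S : Rd d → ℝ) : Prop :=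
  ∀ ε : ℝ, 0 < ε →
    ∃ F₀ : Finset (Cube d), ↑F₀ ⊆ D.cubes ∧
      ∀ F : Finset (Cube d), ↑F ⊆ D.cubes → F₀ ⊆ F →
        wnorm q lam (fun x => parasum D b f F x - S x) < ENNReal.ofReal ε

/-- A modulus of continuity: increasing with `ω(t) → 0` as `t → 0`. -/
def ModulusOfContinuity (ω : ℝ → ℝ) : Prop :=
  Monotone ω ∧ (∀ t, 0 ≤ ω t) ∧ Tendsto ω (nhdsWithin 0 (Ioi 0)) (nhds 0)

/-- The Dini condition `∫₀¹ ω(t)/t dt < ∞`. -/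
def DiniCondition (ω : ℝ → ℝ) : Prop :=
  IntegrableOn (fun t => ω t / t) (Ioc (0 : ℝ) 1) volume

/-- An `ω`-Calderón–Zygmund kernel. -/
structure CZKernel (d : ℕ) (ω : ℝ → ℝ) where
  kernel : Rd d → Rd d → ℝ
  CK : ℝ
  CK_pos : 0 < CK
  size : ∀ x y : Rd d, x ≠ y → |kernel x y| ≤ CK / dist x y ^ d
  smooth : ∀ x x' y : Rd d, x ≠ y → dist x x' ≤ dist x y / 2 →
    |kernel x y - kernel x' y| + |kernel y x - kernel y x'| ≤
      1 / dist x y ^ d * ω (dist x x' / dist x y)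

/-- Non-degeneracy of a Calderón–Zygmund kernel. -/
def CZKernel.NonDegenerate {d : ℕ} {ω : ℝ → ℝ} (K : CZKernel d ω) : Prop :=
  ∃ c : ℝ, 0 < c ∧ ∀ (x : Rd d) (r : ℝ), 0 < r →
    ∃ y : Rd d, c * r ≤ dist x y ∧ c / r ^ d ≤ |K.kernel y x|

/-- An `ω`-Calderón–Zygmund operator: a linear operator, bounded on some `L^{p₀}`, with an
`ω`-Calderón–Zygmund kernel representation off the support. -/
structure CZOperator (d : ℕ) (ω : ℝ → ℝ) extends CZKernel d ω where
  T : (Rd d → ℝ) → Rd d → ℝ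
  map_add : ∀ f g : Rd d → ℝ, T (f + g) = T f + T g
  map_smul : ∀ (c : ℝ) (f : Rd d → ℝ), T (c • f) = c • T f
  measurable_map : ∀ f : Rd d → ℝ, Measurable f → Measurable (T f)
  p₀ : ℝ
  one_lt_p₀ : 1 < p₀
  N₀ : ℝ
  bounded : ∀ f : Rd d → ℝ, Measurable f →
    wnorm p₀ (fun _ => 1) (T f) ≤ ENNReal.ofReal N₀ * wnorm p₀ (fun _ => 1) f
  kernel_repr : ∀ f : Rd d → ℝ, BddCompactSupp f → ∀ x ∉ tsupport f,
    T f x = ∫ y, kernel x y * f y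

/-- The commutator `[b, T] f = b · Tf − T(b f)`. -/
def commutatorOp (b : Rd d → ℝ) (T : (Rd d → ℝ) → Rd d → ℝ) : (Rd d → ℝ) → Rd d → ℝ :=
  fun f x => b x * T f x - T (fun y => b y * f y) x

/-- The sparse operator `𝒜^⋆_{S,b} f = Σ_{Q∈S} ⟨|b − ⟨b⟩_Q| |f|⟩_Q 1_Q`. -/
def sparseOpStar (S : Set (Cube d)) (b f : Rd d → ℝ) (x : Rd d) : ℝ≥0∞ :=
  ∑' Q : S, (Q : Cube d).carrier.indicator
      (fun _ => ENNReal.ofReal (avg (Q : Cube d) fun y => |b y - avg (Q : Cube d) b| * |f y|)) x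

/-- The sparse operator `f ↦ Σ_{Q∈S} ⟨|b − ⟨b⟩_Q|⟩_Q ⟨|f|⟩_Q 1_Q`. -/
def sparseOp2 (S : Set (Cube d)) (b f : Rd d → ℝ) (x : Rd d) : ℝ≥0∞ :=
  ∑' Q : S, (Q : Cube d).carrier.indicator
      (fun _ => ENNReal.ofReal ((avg (Q : Cube d) fun y => |b y - avg (Q : Cube d) b|) *
        avg (Q : Cube d) fun y => |f y|)) x

/-- The sparse operator `f ↦ Σ_{Q∈S} (|Q|^{-s} ∫_Q |f|^s)^{1/s} 1_Q`. -/
def sparseOpPow (S : Set (Cube d)) (s : ℝ) (f : Rd d → ℝ) (x : Rd d) : ℝ≥0∞ :=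
  ∑' Q : S, (Q : Cube d).carrier.indicator
      (fun _ => ENNReal.ofReal (((Q : Cube d).vol ^ (-s) *
        intC (Q : Cube d) fun y => |f y| ^ s) ^ (1 / s))) x

/-! ### Elementary inequalities for sums and powers -/

lemma sum_rpow_le_rpow_sum {ι : Type*} (s : Finset ι) (a : ι → ℝ≥0∞) {t : ℝ} (ht : 1 ≤ t) :
    ∑ i ∈ s, a i ^ t ≤ (∑ i ∈ s, a i) ^ t := by
  classical
  induction s using Finset.induction_on with
  | empty => simp
  | insert i s hi ih =>
    rw [Finset.sum_insert hi, Finset.sum_insert hi]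
    exact (add_le_add_right ih _).trans (ENNReal.add_rpow_le_rpow_add _ _ ht)

lemma rpow_sum_le_sum_rpow {ι : Type*} (s : Finset ι) (a : ι → ℝ≥0∞) {t : ℝ} (h0 : 0 < t)
    (ht : t ≤ 1) : (∑ i ∈ s, a i) ^ t ≤ ∑ i ∈ s, a i ^ t := by
  classical
  induction s using Finset.induction_on with
  | empty => simp [h0]
  | insert i s hi ih =>
    rw [Finset.sum_insert hi, Finset.sum_insert hi]
    exact (ENNReal.rpow_add_le_add_rpow _ _ h0.le ht).trans (add_le_add_right ih _)

/-- Hölder's inequality for sums, with exponents adding up to at least one. -/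
lemma sum_rpow_mul_rpow_le {ι : Type*} (s : Finset ι) (a b : ι → ℝ≥0∞) {x y : ℝ}
    (hx : 0 ≤ x) (hy : 0 ≤ y) (hxy : 1 ≤ x + y) :
    ∑ i ∈ s, a i ^ x * b i ^ y ≤ (∑ i ∈ s, a i) ^ x * (∑ i ∈ s, b i) ^ y := by
  have ht : 0 < x + y := by linarith
  have key : ∑ i ∈ s, a i ^ (x / (x + y)) * b i ^ (y / (x + y)) ≤
      (∑ i ∈ s, a i) ^ (x / (x + y)) * (∑ i ∈ s, b i) ^ (y / (x + y)) := by
    let m : MeasurableSpace ι := ⊤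
    have := ENNReal.lintegral_mul_norm_pow_le
      (μ := ∑ i ∈ s, Measure.dirac i) (f := a) (g := b)
      (p := x / (x + y)) (q := y / (x + y)) measurable_from_top.aemeasurable
      measurable_from_top.aemeasurable (by positivity) (by positivity) (by field_simp)
    simpa [lintegral_finsetSum_measure, lintegral_dirac] using this
  calc ∑ i ∈ s, a i ^ x * b i ^ y
      = ∑ i ∈ s, (a i ^ (x / (x + y)) * b i ^ (y / (x + y))) ^ (x + y) := by
        refine Finset.sum_congr rfl fun i _ => ?_
        rw [ENNReal.mul_rpow_of_nonneg _ _ ht.le, ← ENNReal.rpow_mul, ← ENNReal.rpow_mul,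
          div_mul_cancel₀ _ ht.ne', div_mul_cancel₀ _ ht.ne']
    _ ≤ (∑ i ∈ s, a i ^ (x / (x + y)) * b i ^ (y / (x + y))) ^ (x + y) :=
        sum_rpow_le_rpow_sum s _ hxy
    _ ≤ ((∑ i ∈ s, a i) ^ (x / (x + y)) * (∑ i ∈ s, b i) ^ (y / (x + y))) ^ (x + y) := by
        gcongr
    _ = _ := by
        rw [ENNReal.mul_rpow_of_nonneg _ _ ht.le, ← ENNReal.rpow_mul, ← ENNReal.rpow_mul,
          div_mul_cancel₀ _ ht.ne', div_mul_cancel₀ _ ht.ne']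

lemma sum_rpow_mul_rpow_mul_rpow_le {ι : Type*} (s : Finset ι) (a b c : ι → ℝ≥0∞) {x y z : ℝ}
    (hx : 0 < x) (hy : 0 ≤ y) (hz : 0 ≤ z) (h : 1 ≤ x + y + z) :
    ∑ i ∈ s, a i ^ x * b i ^ y * c i ^ z ≤
      (∑ i ∈ s, a i) ^ x * (∑ i ∈ s, b i) ^ y * (∑ i ∈ s, c i) ^ z := by
  have ht : 0 < x + y := by linarith
  have e : ∀ u v : ℝ≥0∞, (u ^ (x / (x + y)) * v ^ (y / (x + y))) ^ (x + y) = u ^ x * v ^ y := by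
    intro u v
    rw [ENNReal.mul_rpow_of_nonneg _ _ ht.le, ← ENNReal.rpow_mul, ← ENNReal.rpow_mul,
      div_mul_cancel₀ _ ht.ne', div_mul_cancel₀ _ ht.ne']
  have h1 := sum_rpow_mul_rpow_le s (fun i => a i ^ (x / (x + y)) * b i ^ (y / (x + y))) c
    ht.le hz h
  have h2 := sum_rpow_mul_rpow_le s a b (x := x / (x + y)) (y := y / (x + y))
    (by positivity) (by positivity) (by rw [← add_div, div_self ht.ne'])
  simp only [e] at h1
  refine h1.trans ?_
  rw [← e]
  gcongr

/-- A discrete form of `(Tᵖ)' = p Tᵖ⁻¹`. -/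
lemma add_rpow_le_add_mul (a b : ℝ≥0∞) {q : ℝ} (hq : 1 ≤ q) :
    (a + b) ^ q ≤ ENNReal.ofReal q * (a * (a + b) ^ (q - 1)) + b ^ q := by
  rcases eq_or_ne a ⊤ with rfl | ha
  · rcases hq.eq_or_lt with rfl | hq'
    · simp
    · have : ENNReal.ofReal q ≠ 0 := by simp; linarith
      simp [ENNReal.top_rpow_of_pos (sub_pos.2 hq'), ENNReal.mul_top this]
  rcases eq_or_ne b ⊤ with rfl | hb
  · simp [ENNReal.top_rpow_of_pos (by linarith : 0 < q)]
  lift a to NNReal using ha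
  lift b to NNReal using hb
  rcases eq_or_ne (a + b) 0 with h0 | h0
  · have : (a : ℝ≥0∞) + b = 0 := by exact_mod_cast h0
    rw [this, ENNReal.zero_rpow_of_pos (by linarith)]
    exact zero_le
  have hpos : 0 < (a : ℝ) + b := by
    have : 0 < a + b := pos_iff_ne_zero.2 h0
    exact_mod_cast this
  have hab : 0 ≤ (b : ℝ) / (a + b) := by positivity
  have bern := one_add_mul_self_le_rpow_one_add (s := -((a : ℝ) / (a + b))) (p := q)
    (by rw [neg_le_neg_iff, div_le_one hpos]; linarith [b.coe_nonneg]) hq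
  have e1 : 1 + -((a : ℝ) / (a + b)) = b / (a + b) := by field_simp; ring
  rw [e1, Real.div_rpow b.coe_nonneg hpos.le, le_div_iff₀ (by positivity)] at bern
  have e2 : ((a : ℝ) + b) ^ q = (a + b) * (a + b) ^ (q - 1) := by
    rw [Real.rpow_sub_one hpos.ne']; field_simp
  have main : ((a : ℝ) + b) ^ q ≤ q * (a * (a + b) ^ (q - 1)) + (b : ℝ) ^ q := by
    have e3 : (1 + q * -((a : ℝ) / (a + b))) * (a + b) ^ q =
        (a + b) ^ q - q * (a * (a + b) ^ (q - 1)) := by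
      rw [e2]; field_simp; ring
    linarith
  have hq0 : 0 ≤ q := by linarith
  have hq1 : 0 ≤ q - 1 := by linarith
  rw [← ENNReal.coe_add, ← ENNReal.coe_rpow_of_nonneg _ hq0, ← ENNReal.coe_rpow_of_nonneg _ hq1,
    ← ENNReal.coe_rpow_of_nonneg _ hq0, ENNReal.ofReal, ← ENNReal.coe_mul, ← ENNReal.coe_mul,
    ← ENNReal.coe_add, ENNReal.coe_le_coe, ← NNReal.coe_le_coe]
  push_cast
  rw [Real.coe_toNNReal _ hq0]
  exact main

/-! ### Finite nested sparse families of sets -/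

/-- A finite family of measurable sets, any two of them nested or disjoint, which is sparse with
respect to the measure `N`. -/
structure SparseNested {α : Type*} [MeasurableSpace α] (T : Finset (Set α)) (E : Set α → Set α)
    (N : Measure α) (γ : ℝ) : Prop where
  meas : ∀ A ∈ T, MeasurableSet A
  nested : ∀ A ∈ T, ∀ B ∈ T, A ⊆ B ∨ B ⊆ A ∨ Disjoint A B
  nonempty : ∀ A ∈ T, A.Nonempty
  sub : ∀ A ∈ T, E A ⊆ A
  measE : ∀ A ∈ T, MeasurableSet (E A)
  disj : (T : Set (Set α)).PairwiseDisjoint E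
  fin : ∀ A ∈ T, N A ≠ ⊤
  le : ∀ A ∈ T, ENNReal.ofReal γ * N A ≤ N (E A)

lemma SparseNested.mono {α : Type*} [MeasurableSpace α] {T U : Finset (Set α)}
    {E : Set α → Set α} {N : Measure α} {γ : ℝ} (h : SparseNested T E N γ) (hU : U ⊆ T) :
    SparseNested U E N γ where
  meas A hA := h.meas A (hU hA)
  nested A hA B hB := h.nested A (hU hA) B (hU hB)
  nonempty A hA := h.nonempty A (hU hA)
  sub A hA := h.sub A (hU hA)
  measE A hA := h.measE A (hU hA)
  disj := h.disj.subset (by exact_mod_cast hU)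
  fin A hA := h.fin A (hU hA)
  le A hA := h.le A (hU hA)

open Classical in
lemma pairwiseDisjoint_maximal {α : Type*} {T : Finset (Set α)}
    (h : ∀ A ∈ T, ∀ B ∈ T, A ⊆ B ∨ B ⊆ A ∨ Disjoint A B) :
    ((T.filter fun A => Maximal (· ∈ T) A : Finset (Set α)) : Set (Set α)).PairwiseDisjoint id := by
  intro A hA B hB hAB
  simp only [Finset.coe_filter, mem_ofPred_eq] at hA hB
  rcases h A hA.1 B hB.1 with h1 | h1 | h1
  · exact absurd (h1.antisymm (hA.2.2 hB.1 h1)) hAB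
  · exact absurd (h1.antisymm (hB.2.2 hA.1 h1)).symm hAB
  · exact h1

lemma sum_measure_le_of_disjoint {α : Type*} [MeasurableSpace α] (T : Finset (Set α))
    (F : Set α → Set α) (hm : ∀ A ∈ T, MeasurableSet (F A))
    (hd : (T : Set (Set α)).PairwiseDisjoint F) (μ : Measure α) {R : Set α}
    (hR : ∀ A ∈ T, F A ⊆ R) : ∑ A ∈ T, μ (F A) ≤ μ R := by
  rw [← measure_biUnion_finset hd hm]
  exact measure_mono (iUnion₂_subset hR)

/-- For a sparse family, the mass of the maximal sets controls the total mass. -/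
lemma SparseNested.carleson_maximal {α : Type*} [MeasurableSpace α] {T : Finset (Set α)}
    {E : Set α → Set α} {N : Measure α} {γ : ℝ} (h : SparseNested T E N γ) :
    open Classical in
    ENNReal.ofReal γ * ∑ A ∈ T, N A ≤ ∑ A ∈ T.filter (fun A => Maximal (· ∈ T) A), N A := by
  classical
  rw [Finset.mul_sum]
  refine (Finset.sum_le_sum fun A hA => h.le A hA).trans ?_
  rw [← measure_biUnion_finset h.disj h.measE]
  refine le_trans (measure_mono ?_) (measure_biUnion_finset_le _ _)
  refine iUnion₂_subset fun A hA => (h.sub A hA).trans ?_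
  obtain ⟨B, hAB, hB⟩ := Finset.exists_le_maximal T hA
  exact subset_trans hAB (subset_biUnion_of_mem (u := fun B : Set α => B)
    (by simpa using ⟨hB.1, hB⟩))

lemma SparseNested.carleson {α : Type*} [MeasurableSpace α] {T : Finset (Set α)}
    {E : Set α → Set α} {N : Measure α} {γ : ℝ} (h : SparseNested T E N γ) {R : Set α}
    (hR : ∀ A ∈ T, A ⊆ R) : ENNReal.ofReal γ * ∑ A ∈ T, N A ≤ N R := by
  classical
  refine h.carleson_maximal.trans ?_
  refine sum_measure_le_of_disjoint _ id (fun A hA => h.meas A (Finset.mem_filter.1 hA).1)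
    (pairwiseDisjoint_maximal h.nested) N fun A hA => hR A (Finset.mem_filter.1 hA).1

/-- A Kolmogorov type inequality for sparse families. -/
lemma SparseNested.sum_rpow_le {α : Type*} [MeasurableSpace α] {T : Finset (Set α)}
    {E : Set α → Set α} {N : Measure α} {γ : ℝ} (h : SparseNested T E N γ)
    (hγ1 : γ < 1) {δ β ζ : ℝ} (hδ : 0 < δ) (hβ : 0 ≤ β) (hζ : 0 ≤ ζ)
    (hsum : 1 ≤ δ + β + ζ) {K : ℝ≥0∞} (hK : 1 + K * ENNReal.ofReal (1 - γ) ^ δ ≤ K)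
    (hγ : 0 < γ) (ν Φ : Measure α) {R : Set α} (hR : ∀ A ∈ T, A ⊆ R) :
    ∑ A ∈ T, N A ^ δ * ν A ^ β * Φ A ^ ζ ≤
      K * ((∑ A ∈ T, N A) ^ δ * ν R ^ β * Φ R ^ ζ) := by
  classical
  induction T using Finset.strongInduction with
  | H T ih =>
  rcases T.eq_empty_or_nonempty with rfl | hne
  · simp
  set M := T.filter fun A => Maximal (· ∈ T) A with hM
  set U := T.filter fun A => ¬ Maximal (· ∈ T) A with hU
  have hMT : M ⊆ T := Finset.filter_subset _ _
  have hUT : U ⊂ T := by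
    refine Finset.filter_ssubset.2 ?_
    obtain ⟨A, hA⟩ := hne
    obtain ⟨B, -, hB⟩ := Finset.exists_le_maximal T hA
    exact ⟨B, hB.1, not_not.2 hB⟩
  have split : ∀ φ : Set α → ℝ≥0∞, ∑ A ∈ T, φ A = ∑ A ∈ M, φ A + ∑ A ∈ U, φ A := fun φ =>
    (Finset.sum_filter_add_sum_filter_not T _ φ).symm
  have hAfin : ∑ A ∈ T, N A ≠ ⊤ := ENNReal.sum_ne_top.2 h.fin
  have hrest : ∑ A ∈ U, N A ≤ ENNReal.ofReal (1 - γ) * ∑ A ∈ T, N A := by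
    have h1 := h.carleson_maximal
    have h2 := split fun A => N A
    have hMfin : ∑ A ∈ M, N A ≠ ⊤ := ENNReal.sum_ne_top.2 fun A hA => h.fin A (hMT hA)
    have h3 : ENNReal.ofReal (1 - γ) * ∑ A ∈ T, N A + ENNReal.ofReal γ * ∑ A ∈ T, N A =
        ∑ A ∈ T, N A := by
      rw [← add_mul, ← ENNReal.ofReal_add (by linarith) hγ.le]; simp
    refine (ENNReal.add_le_add_iff_right hMfin).1 ?_
    calc ∑ A ∈ U, N A + ∑ A ∈ M, N A = ∑ A ∈ T, N A := by rw [h2, add_comm]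
      _ = _ := h3.symm
      _ ≤ _ := by gcongr
  have hmax : ∑ A ∈ M, N A ^ δ * ν A ^ β * Φ A ^ ζ ≤
      (∑ A ∈ T, N A) ^ δ * ν R ^ β * Φ R ^ ζ := by
    have hd := pairwiseDisjoint_maximal h.nested
    refine (sum_rpow_mul_rpow_mul_rpow_le M (fun A => N A) (fun A => ν A) (fun A => Φ A)
      hδ hβ hζ hsum).trans ?_
    have hle : ∀ μ : Measure α, ∑ A ∈ M, μ A ≤ μ R := fun μ =>
      sum_measure_le_of_disjoint M id (fun A hA => h.meas A (hMT hA)) hd μ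
        fun A hA => hR A (hMT hA)
    gcongr
    · exact hle ν
    · exact hle Φ
  have hind := ih U hUT (h.mono hUT.1) fun A hA => hR A (hUT.1 hA)
  rw [split]
  calc _ ≤ (∑ A ∈ T, N A) ^ δ * ν R ^ β * Φ R ^ ζ +
        K * ((ENNReal.ofReal (1 - γ) * ∑ A ∈ T, N A) ^ δ * ν R ^ β * Φ R ^ ζ) := by
        refine add_le_add hmax (hind.trans ?_)
        gcongr
    _ = (1 + K * ENNReal.ofReal (1 - γ) ^ δ) * ((∑ A ∈ T, N A) ^ δ * ν R ^ β * Φ R ^ ζ) := by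
        rw [ENNReal.mul_rpow_of_nonneg _ _ hδ.le]; ring
    _ ≤ _ := by gcongr

/-- The Kolmogorov type inequality with a constant depending on `γ` and `δ` only. -/
lemma exists_kolmogorov_const {γ δ : ℝ} (hγ : 0 < γ) (hγ1 : γ < 1) (hδ : 0 < δ) :
    ∃ K : ℝ≥0∞, K ≠ ⊤ ∧ ∀ {α : Type*} [MeasurableSpace α] {T : Finset (Set α)}
      {E : Set α → Set α} {N : Measure α}, SparseNested T E N γ →
      ∀ {β ζ : ℝ}, 0 ≤ β → 0 ≤ ζ → 1 ≤ δ + β + ζ → ∀ (ν Φ : Measure α) {R : Set α},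
      (∀ A ∈ T, A ⊆ R) →
      ∑ A ∈ T, N A ^ δ * ν A ^ β * Φ A ^ ζ ≤ K * (N R ^ δ * ν R ^ β * Φ R ^ ζ) := by
  have hr : ENNReal.ofReal (1 - γ) ^ δ < 1 :=
    ENNReal.rpow_lt_one (by rw [ENNReal.ofReal_lt_one]; linarith) hδ
  set r := ENNReal.ofReal (1 - γ) ^ δ
  have hK : (1 - r)⁻¹ ≠ ⊤ := by simpa using (tsub_pos_of_lt hr).ne'
  have hg0 : ENNReal.ofReal γ ≠ 0 := by simpa using hγ
  refine ⟨(1 - r)⁻¹ * ((ENNReal.ofReal γ)⁻¹) ^ δ, ENNReal.mul_ne_top hK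
    (ENNReal.rpow_ne_top_of_nonneg hδ.le (by simpa using hγ)), ?_⟩
  intro α _ T E N h β ζ hβ hζ hsum ν Φ R hR
  have hK1 : 1 + (1 - r)⁻¹ * r ≤ (1 - r)⁻¹ := by
    have h1 : (1 - r)⁻¹ * (1 - r) = 1 := ENNReal.inv_mul_cancel (tsub_pos_of_lt hr).ne'
      (ENNReal.sub_ne_top ENNReal.one_ne_top)
    calc 1 + (1 - r)⁻¹ * r = (1 - r)⁻¹ * ((1 - r) + r) := by rw [mul_add, h1]
      _ = (1 - r)⁻¹ := by rw [tsub_add_cancel_of_le hr.le, mul_one]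
      _ ≤ _ := le_rfl
  refine (h.sum_rpow_le hγ1 hδ hβ hζ hsum hK1 hγ ν Φ hR).trans ?_
  have hA : ∑ A ∈ T, N A ≤ (ENNReal.ofReal γ)⁻¹ * N R := by
    rw [mul_comm, ← div_eq_mul_inv,
      ENNReal.le_div_iff_mul_le (Or.inl hg0) (Or.inl ENNReal.ofReal_ne_top), mul_comm]
    exact h.carleson hR
  calc _ ≤ (1 - r)⁻¹ * (((ENNReal.ofReal γ)⁻¹ * N R) ^ δ * ν R ^ β * Φ R ^ ζ) := by gcongr
    _ = _ := by rw [ENNReal.mul_rpow_of_nonneg _ _ hδ.le]; ring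

/-! ### Logarithmic coordinates -/

/-- `exp`, as a map into the extended nonnegative reals. -/
def eexp (t : ℝ) : ℝ≥0∞ := ENNReal.ofReal (Real.exp t)

lemma exists_eq_eexp {x : ℝ≥0∞} (h0 : x ≠ 0) (ht : x ≠ ⊤) : ∃ t, x = eexp t :=
  ⟨Real.log x.toReal, by
    rw [eexp, Real.exp_log (ENNReal.toReal_pos h0 ht), ENNReal.ofReal_toReal ht]⟩

lemma eexp_mul (s t : ℝ) : eexp s * eexp t = eexp (s + t) := by
  rw [eexp, eexp, eexp, ← ENNReal.ofReal_mul (Real.exp_pos s).le, Real.exp_add]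

lemma eexp_rpow (s r : ℝ) : eexp s ^ r = eexp (s * r) := by
  rw [eexp, eexp, ENNReal.ofReal_rpow_of_pos (Real.exp_pos s), Real.exp_mul]

lemma eexp_div (s t : ℝ) : eexp s / eexp t = eexp (s - t) := by
  rw [eexp, eexp, eexp, ← ENNReal.ofReal_div_of_pos (Real.exp_pos t), Real.exp_sub]

lemma eexp_le {s t : ℝ} : eexp s ≤ eexp t ↔ s ≤ t := by
  rw [eexp, eexp, ENNReal.ofReal_le_ofReal_iff (Real.exp_pos t).le, Real.exp_le_exp]

/-- Absorption of a power of a finite quantity. -/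
lemma le_rpow_of_le_mul_rpow {J Y : ℝ≥0∞} {t : ℝ} (hJ : J ≠ ⊤) (ht : 0 < t)
    (h : J ≤ Y * J ^ (1 - t)) : J ≤ Y ^ (1 / t) := by
  rcases eq_or_ne J 0 with rfl | h0
  · exact zero_le
  have h1 : J ^ t ≤ Y := by
    have hne0 : J ^ (1 - t) ≠ 0 := by simp [ENNReal.rpow_eq_zero_iff, h0, hJ]
    have hnet : J ^ (1 - t) ≠ ⊤ := by simp [ENNReal.rpow_eq_top_iff, h0, hJ]
    rw [← ENNReal.mul_le_mul_iff_left hne0 hnet, ← ENNReal.rpow_add _ _ h0 hJ]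
    simpa using h
  calc J = (J ^ t) ^ (1 / t) := by
        rw [← ENNReal.rpow_mul, mul_one_div_cancel ht.ne', ENNReal.rpow_one]
    _ ≤ _ := by gcongr

/-! ### Sums of multiples of indicators over finite families -/

/-- The function `∑_{A ∈ T} c_A 1_A`. -/
def famSum {α : Type*} (T : Finset (Set α)) (c : Set α → ℝ≥0∞) (x : α) : ℝ≥0∞ :=
  ∑ A ∈ T, A.indicator (fun _ => c A) x

section famSum

variable {α : Type*} {T U : Finset (Set α)} {c : Set α → ℝ≥0∞}

lemma famSum_mono (h : T ⊆ U) (x : α) : famSum T c x ≤ famSum U c x :=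
  Finset.sum_le_sum_of_subset h

lemma measurable_famSum [MeasurableSpace α] (hT : ∀ A ∈ T, MeasurableSet A) :
    Measurable (famSum T c) :=
  Finset.measurable_fun_sum _ fun A hA => measurable_const.indicator (hT A hA)

lemma famSum_ne_top (hc : ∀ A ∈ T, c A ≠ ⊤) (x : α) : famSum T c x ≠ ⊤ := by
  refine ENNReal.sum_ne_top.2 fun A hA => ?_
  by_cases hx : x ∈ A <;> simp [hx, hc A hA]

lemma lintegral_famSum_mul [MeasurableSpace α] (hT : ∀ A ∈ T, MeasurableSet A)
    {g : α → ℝ≥0∞} (hg : Measurable g) (μ : Measure α) :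
    ∫⁻ x, famSum T c x * g x ∂μ = ∑ A ∈ T, c A * ∫⁻ x in A, g x ∂μ := by
  simp only [famSum, Finset.sum_mul]
  rw [lintegral_finsetSum]
  · refine Finset.sum_congr rfl fun A hA => ?_
    rw [← lintegral_const_mul _ hg, ← lintegral_indicator (hT A hA)]
    congr with x
    by_cases hx : x ∈ A <;> simp [hx]
  · exact fun A hA => (measurable_const.indicator (hT A hA)).mul hg

lemma lintegral_famSum_rpow_ne_top [MeasurableSpace α] (hT : ∀ A ∈ T, MeasurableSet A)
    (hc : ∀ A ∈ T, c A ≠ ⊤) {μ : Measure α} (hμ : ∀ A ∈ T, μ A ≠ ⊤) {r : ℝ} (hr : 0 < r) :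
    ∫⁻ x, famSum T c x ^ r ∂μ ≠ ⊤ := by
  have hC : (∑ A ∈ T, c A) ^ r ≠ ⊤ :=
    ENNReal.rpow_ne_top_of_nonneg hr.le (ENNReal.sum_ne_top.2 hc)
  have hle : ∀ x, famSum T c x ^ r ≤ famSum T (fun _ => (∑ A ∈ T, c A) ^ r) x := by
    intro x
    by_cases h : ∃ A ∈ T, x ∈ A
    · obtain ⟨A, hA, hx⟩ := h
      calc famSum T c x ^ r ≤ (∑ A ∈ T, c A) ^ r := by
            refine ENNReal.rpow_le_rpow (Finset.sum_le_sum fun B _ => ?_) hr.le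
            by_cases hB : x ∈ B <;> simp [hB]
        _ = A.indicator (fun _ => (∑ A ∈ T, c A) ^ r) x := by simp [hx]
        _ ≤ _ := Finset.single_le_sum
            (f := fun A : Set α => A.indicator (fun _ => (∑ A ∈ T, c A) ^ r) x)
            (fun _ _ => zero_le) hA
    · push Not at h
      have : famSum T c x = 0 := Finset.sum_eq_zero fun A hA => by simp [h A hA]
      rw [this, ENNReal.zero_rpow_of_pos hr]
      exact zero_le
  refine ne_top_of_le_ne_top ?_ (lintegral_mono hle)
  have := lintegral_famSum_mul (c := fun _ => (∑ A ∈ T, c A) ^ r) hT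
    (measurable_const (a := (1 : ℝ≥0∞))) μ
  simp only [mul_one, lintegral_const, Measure.restrict_apply_univ, one_mul] at this
  rw [this]
  exact ENNReal.sum_ne_top.2 fun A hA => ENNReal.mul_ne_top hC (hμ A hA)

open Classical in
/-- The chain lemma: a power of a sum over a nested family is controlled by the corresponding
sum of localized powers. -/
lemma famSum_rpow_le (hT : ∀ A ∈ T, ∀ B ∈ T, A ⊆ B ∨ B ⊆ A ∨ Disjoint A B) {m : ℝ} (hm : 1 ≤ m)
    (x : α) :
    famSum T c x ^ m ≤ ENNReal.ofReal m *
      ∑ A ∈ T, A.indicator (fun _ => c A) x * famSum (T.filter (· ⊆ A)) c x ^ (m - 1) := by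
  induction T using Finset.strongInduction with
  | H T ih =>
  by_cases h : ∃ A ∈ T, x ∈ A
  swap
  · push Not at h
    have : famSum T c x = 0 := Finset.sum_eq_zero fun A hA => by simp [h A hA]
    rw [this, ENNReal.zero_rpow_of_pos (by linarith)]
    exact zero_le
  obtain ⟨A₀, hA₀, hx₀⟩ := h
  obtain ⟨A, -, hA⟩ := Finset.exists_le_maximal (T.filter (x ∈ ·))
    (Finset.mem_filter.2 ⟨hA₀, hx₀⟩)
  obtain ⟨hAT, hxA⟩ := Finset.mem_filter.1 hA.1
  have hsub : ∀ B ∈ T, x ∈ B → B ⊆ A := by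
    intro B hB hxB
    rcases hT A hAT B hB with h1 | h1 | h1
    · exact hA.2 (Finset.mem_filter.2 ⟨hB, hxB⟩) h1
    · exact h1
    · exact absurd hxB (disjoint_left.1 h1 hxA)
  have e1 : famSum T c x = c A + famSum (T.erase A) c x := by
    rw [famSum, ← Finset.add_sum_erase _ _ hAT]
    simp [hxA, famSum]
  have e2 : famSum (T.filter (· ⊆ A)) c x = famSum T c x := by
    rw [famSum, Finset.sum_filter, famSum]
    refine Finset.sum_congr rfl fun B hB => ?_
    by_cases hxB : x ∈ B
    · simp [hsub B hB hxB]
    · simp [hxB]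
  have hI := ih (T.erase A) (Finset.erase_ssubset hAT)
    (fun B hB D hD => hT B (Finset.mem_of_mem_erase hB) D (Finset.mem_of_mem_erase hD))
  rw [← Finset.add_sum_erase _ _ hAT, e2, mul_add, e1]
  refine (add_rpow_le_add_mul _ _ hm).trans (add_le_add ?_ (hI.trans ?_))
  · simp [hxA]
  · gcongr with B hB
    exact famSum_mono (Finset.filter_subset_filter _ (Finset.erase_subset _ _)) x

end famSum

/-! ### Testing inequalities -/

/-- Two measures `ν`, `μ` satisfying a joint Muckenhoupt type condition on a sparse family. -/
structure TwoWeight {α : Type*} [MeasurableSpace α] (T : Finset (Set α)) (E : Set α → Set α)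
    (N : Measure α) (γ a : ℝ) (ν μ : Measure α) (V : ℝ≥0∞) : Prop where
  sparse : SparseNested T E N γ
  N_pos : ∀ A ∈ T, N A ≠ 0
  ν_pos : ∀ A ∈ T, ν A ≠ 0
  ν_fin : ∀ A ∈ T, ν A ≠ ⊤
  μ_pos : ∀ A ∈ T, μ A ≠ 0
  μ_fin : ∀ A ∈ T, μ A ≠ ⊤
  V_pos : V ≠ 0
  V_fin : V ≠ ⊤
  le : ∀ A ∈ T, ν A ^ (1 - a) * μ A ^ a ≤ V * N A

lemma TwoWeight.mono {α : Type*} [MeasurableSpace α] {T U : Finset (Set α)}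
    {E : Set α → Set α} {N : Measure α} {γ a : ℝ} {ν μ : Measure α} {V : ℝ≥0∞}
    (h : TwoWeight T E N γ a ν μ V) (hU : U ⊆ T) : TwoWeight U E N γ a ν μ V where
  sparse := h.sparse.mono hU
  N_pos A hA := h.N_pos A (hU hA)
  ν_pos A hA := h.ν_pos A (hU hA)
  ν_fin A hA := h.ν_fin A (hU hA)
  μ_pos A hA := h.μ_pos A (hU hA)
  μ_fin A hA := h.μ_fin A (hU hA)
  V_pos := h.V_pos
  V_fin := h.V_fin
  le A hA := h.le A (hU hA)

/-- The coefficients `μ(A)ᵉ ν(A) / N(A)`. -/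
def fracCoef {α : Type*} [MeasurableSpace α] (N ν μ : Measure α) (e : ℝ) (A : Set α) : ℝ≥0∞ :=
  μ A ^ e * ν A / N A

section Testing

variable {α : Type*} [MeasurableSpace α] {T : Finset (Set α)} {E : Set α → Set α}
  {N ν μ : Measure α} {γ a m : ℝ} {V : ℝ≥0∞}

lemma TwoWeight.fracCoef_ne_top (h : TwoWeight T E N γ a ν μ V) (e : ℝ) {A : Set α}
    (hA : A ∈ T) : fracCoef N ν μ e A ≠ ⊤ := by
  refine ENNReal.div_ne_top (ENNReal.mul_ne_top ?_ (h.ν_fin A hA)) (h.N_pos A hA)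
  simp [ENNReal.rpow_eq_top_iff, h.μ_pos A hA, h.μ_fin A hA]

/-- Logarithmic coordinates for all the quantities attached to a set of the family. -/
lemma TwoWeight.exists_eexp (h : TwoWeight T E N γ a ν μ V) {A : Set α} (hA : A ∈ T) :
    ∃ n s t v : ℝ, N A = eexp n ∧ ν A = eexp s ∧ μ A = eexp t ∧ V = eexp v ∧
      s * (1 - a) + t * a ≤ v + n := by
  obtain ⟨n, hn⟩ := exists_eq_eexp (h.N_pos A hA) (h.sparse.fin A hA)
  obtain ⟨s, hs⟩ := exists_eq_eexp (h.ν_pos A hA) (h.ν_fin A hA)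
  obtain ⟨t, ht⟩ := exists_eq_eexp (h.μ_pos A hA) (h.μ_fin A hA)
  obtain ⟨v, hv⟩ := exists_eq_eexp h.V_pos h.V_fin
  refine ⟨n, s, t, v, hn, hs, ht, hv, ?_⟩
  have := h.le A hA
  rwa [hn, hs, ht, hv, eexp_rpow, eexp_rpow, eexp_mul, eexp_mul, eexp_le] at this

lemma TwoWeight.coef_rpow_mul_le (h : TwoWeight T E N γ a ν μ V) (ha : 0 < a)
    (hm : 1 < m) {e κ : ℝ} (he : e = a - 1 / m) (hκ : e = a * κ)
    {A : Set α} (hA : A ∈ T) :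
    fracCoef N ν μ e A ^ (m - 1) * μ A ≤
      V ^ (m - κ) * (N A ^ (1 - κ) * ν A ^ (a * m - 1 + κ * (1 - a))) := by
  obtain ⟨n, s, t, v, hn, hs, ht, hv, hle⟩ := h.exists_eexp hA
  rw [fracCoef, hn, hs, ht, hv]
  simp only [eexp_rpow, eexp_mul, eexp_div, eexp_le]
  have hmκ : 0 ≤ m - κ := by
    have : a * κ ≤ a * 1 := by
      rw [← hκ, he]
      have : 0 < 1 / m := by positivity
      linarith
    have := le_of_mul_le_mul_left this ha
    linarith
  have h1 := mul_le_mul_of_nonneg_left hle hmκ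
  have h2 : e * (m - 1) + 1 = a * (m - κ) := by
    have : e * m = a * m - 1 := by rw [he]; field_simp
    rw [mul_sub a, ← hκ]
    linarith
  have h3 : t * (e * (m - 1) + 1) = t * (a * (m - κ)) := by rw [h2]
  have h4 : κ * a = a - 1 / m := by rw [mul_comm, ← hκ, he]
  nlinarith [h1, h3]

lemma TwoWeight.coef_mul_le (h : TwoWeight T E N γ a ν μ V)
    {e κ : ℝ} (hκ0 : 0 ≤ κ) (hκ : e = a * κ) {A : Set α} (hA : A ∈ T) :
    fracCoef N ν μ e A * (V ^ (m - κ) * (ν A ^ (a * m - 1 + κ * (1 - a)) * N A ^ (1 - κ))) ≤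
      V ^ m * ν A ^ (a * m) := by
  obtain ⟨n, s, t, v, hn, hs, ht, hv, hle⟩ := h.exists_eexp hA
  rw [fracCoef, hn, hs, ht, hv]
  simp only [eexp_rpow, eexp_mul, eexp_div, eexp_le]
  have h1 := mul_le_mul_of_nonneg_left hle hκ0
  rw [hκ]
  nlinarith [h1]

end Testing

/-- Localized bound for the power `m - 1` of a sum over a sparse family. -/
lemma exists_inner_const {γ a m : ℝ} (hγ : 0 < γ) (hγ1 : γ < 1) (ha : 0 < a) (ha1 : a < 1)
    (hm : 1 < m) (ham : 1 ≤ a * m) {e κ : ℝ} (he : e = a - 1 / m) (hκ : e = a * κ) :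
    ∃ C : ℝ≥0∞, C ≠ ⊤ ∧ ∀ {α : Type*} [MeasurableSpace α] {T : Finset (Set α)}
      {E : Set α → Set α} {N ν μ : Measure α} {V : ℝ≥0∞}, TwoWeight T E N γ a ν μ V →
      ∀ {R : Set α}, (∀ A ∈ T, A ⊆ R) →
      ∫⁻ x, famSum T (fracCoef N ν μ e) x ^ (m - 1) ∂μ ≤
        C * (V ^ (m - κ) * (ν R ^ (a * m - 1 + κ * (1 - a)) * N R ^ (1 - κ))) := by
  have hm0 : 0 < m := by linarith
  have he0 : 0 ≤ e := by
    rw [he, sub_nonneg, div_le_iff₀ hm0]; exact ham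
  have hκ0 : 0 ≤ κ := by
    by_contra! hlt
    nlinarith
  have hκ1 : κ < 1 := by
    by_contra! hge
    have : 0 < 1 / m := by positivity
    nlinarith
  have hβ : 0 ≤ a * m - 1 + κ * (1 - a) := by nlinarith
  have hβδ : 1 ≤ (1 - κ) + (a * m - 1 + κ * (1 - a)) := by
    have : e * m = a * m - 1 := by rw [he]; field_simp
    nlinarith
  set β := a * m - 1 + κ * (1 - a) with hβdef
  rcases le_or_gt (m - 1) 1 with hr | hr
  · obtain ⟨K, hK, hKol⟩ := exists_kolmogorov_const hγ hγ1 (δ := 1 - κ) (by linarith)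
    refine ⟨K, hK, ?_⟩
    intro α _ T E N ν μ V h R hR
    calc ∫⁻ x, famSum T (fracCoef N ν μ e) x ^ (m - 1) ∂μ
        ≤ ∫⁻ x, famSum T (fun A => fracCoef N ν μ e A ^ (m - 1)) x * 1 ∂μ := by
          refine lintegral_mono fun x => ?_
          rw [mul_one]
          refine (rpow_sum_le_sum_rpow _ _ (by linarith) hr).trans_eq ?_
          refine Finset.sum_congr rfl fun A _ => ?_
          by_cases hx : x ∈ A
          · simp [hx]
          · simp [hx, hm]
      _ = ∑ A ∈ T, fracCoef N ν μ e A ^ (m - 1) * μ A := by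
          rw [lintegral_famSum_mul h.sparse.meas measurable_const]
          simp
      _ ≤ ∑ A ∈ T, V ^ (m - κ) * (N A ^ (1 - κ) * ν A ^ β) :=
          Finset.sum_le_sum fun A hA => h.coef_rpow_mul_le ha hm he hκ hA
      _ = V ^ (m - κ) * ∑ A ∈ T, N A ^ (1 - κ) * ν A ^ β * ν A ^ (0 : ℝ) := by
          simp [Finset.mul_sum]
      _ ≤ V ^ (m - κ) * (K * (N R ^ (1 - κ) * ν R ^ β * ν R ^ (0 : ℝ))) := by
          gcongr
          exact hKol h.sparse hβ le_rfl (by linarith) ν ν hR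
      _ = _ := by rw [ENNReal.rpow_zero]; ring
  · set r := m - 1 with hrdef
    have hr0 : 0 < r := by linarith
    obtain ⟨K, hK, hKol⟩ := exists_kolmogorov_const hγ hγ1 (δ := (1 - κ) / r)
      (div_pos (by linarith) hr0)
    refine ⟨K ^ r, ENNReal.rpow_ne_top_of_nonneg hr0.le hK, ?_⟩
    intro α _ T E N ν μ V h R hR
    set c := fracCoef N ν μ e with hc
    set J := ∫⁻ x, famSum T c x ^ r ∂μ with hJ
    set Φ := μ.withDensity fun x => famSum T c x ^ r with hΦ
    have hmeas : Measurable (famSum T c) := measurable_famSum h.sparse.meas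
    have hJfin : J ≠ ⊤ := lintegral_famSum_rpow_ne_top h.sparse.meas
      (fun A hA => h.fracCoef_ne_top e hA) h.μ_fin hr0
    have hΦR : Φ R ≤ J := (measure_mono (subset_univ R)).trans_eq (by
      rw [hΦ, withDensity_apply _ MeasurableSet.univ, Measure.restrict_univ])
    have hterm : ∀ A ∈ T, c A * ∫⁻ x in A, famSum T c x ^ (r - 1) ∂μ ≤
        V ^ ((m - κ) / r) *
          (N A ^ ((1 - κ) / r) * ν A ^ (β / r) * Φ A ^ (1 - 1 / r)) := by
      intro A hA
      have hol := ENNReal.lintegral_mul_norm_pow_le (μ := μ.restrict A)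
        (f := fun x => famSum T c x ^ r) (g := fun _ => 1) (p := 1 - 1 / r) (q := 1 / r)
        (hmeas.pow_const r).aemeasurable measurable_const.aemeasurable
        (by rw [sub_nonneg, div_le_one hr0]; exact hr.le) (by positivity) (by ring)
      have e1 : ∀ x, (famSum T c x ^ r) ^ (1 - 1 / r) = famSum T c x ^ (r - 1) := fun x => by
        rw [← ENNReal.rpow_mul, mul_sub, mul_one_div_cancel hr0.ne', mul_one]
      simp only [e1, ENNReal.one_rpow, mul_one, lintegral_const, one_mul,
        Measure.restrict_apply_univ] at hol
      rw [← withDensity_apply (fun x => famSum T c x ^ r) (h.sparse.meas A hA), ← hΦ] at hol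
      have h2 : c A * μ A ^ (1 / r) ≤
          V ^ ((m - κ) / r) * (N A ^ ((1 - κ) / r) * ν A ^ (β / r)) := by
        have := ENNReal.rpow_le_rpow (h.coef_rpow_mul_le ha hm he hκ hA)
          (show 0 ≤ 1 / r by positivity)
        rw [← hβdef, ← hrdef, ← hc] at this
        have hr' : 0 ≤ 1 / r := by positivity
        simp only [ENNReal.mul_rpow_of_nonneg _ _ hr', ← ENNReal.rpow_mul,
          mul_one_div_cancel hr0.ne', ENNReal.rpow_one, mul_one_div] at this
        exact this
      calc c A * ∫⁻ x in A, famSum T c x ^ (r - 1) ∂μ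
          ≤ c A * (Φ A ^ (1 - 1 / r) * μ A ^ (1 / r)) := by gcongr
        _ = c A * μ A ^ (1 / r) * Φ A ^ (1 - 1 / r) := by ring
        _ ≤ V ^ ((m - κ) / r) * (N A ^ ((1 - κ) / r) * ν A ^ (β / r)) *
              Φ A ^ (1 - 1 / r) := by gcongr
        _ = _ := by ring
    have hmain : J ≤ (K * (V ^ ((m - κ) / r) * (ν R ^ (β / r) * N R ^ ((1 - κ) / r)))) *
        J ^ (1 - 1 / r) := by
      calc J = ∫⁻ x, famSum T c x * famSum T c x ^ (r - 1) ∂μ := by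
            refine lintegral_congr fun x => ?_
            rcases eq_or_ne (famSum T c x) 0 with h0 | h0
            · rw [h0, ENNReal.zero_rpow_of_pos hr0, zero_mul]
            · nth_rw 2 [← ENNReal.rpow_one (famSum T c x)]
              rw [← ENNReal.rpow_add _ _ h0
                (famSum_ne_top (fun A hA => h.fracCoef_ne_top e hA) x)]
              congr 1; ring
        _ = ∑ A ∈ T, c A * ∫⁻ x in A, famSum T c x ^ (r - 1) ∂μ :=
            lintegral_famSum_mul h.sparse.meas (hmeas.pow_const _) μ
        _ ≤ ∑ A ∈ T, V ^ ((m - κ) / r) *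
              (N A ^ ((1 - κ) / r) * ν A ^ (β / r) * Φ A ^ (1 - 1 / r)) :=
            Finset.sum_le_sum hterm
        _ = V ^ ((m - κ) / r) *
              ∑ A ∈ T, N A ^ ((1 - κ) / r) * ν A ^ (β / r) * Φ A ^ (1 - 1 / r) := by
            rw [Finset.mul_sum]
        _ ≤ V ^ ((m - κ) / r) *
              (K * (N R ^ ((1 - κ) / r) * ν R ^ (β / r) * Φ R ^ (1 - 1 / r))) := by
            gcongr
            refine hKol h.sparse (by positivity)
              (by rw [sub_nonneg, div_le_one hr0]; exact hr.le) ?_ ν Φ hR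
            have : 1 / r ≤ ((1 - κ) + β) / r := by gcongr
            rw [add_div] at this
            linarith
        _ ≤ V ^ ((m - κ) / r) *
              (K * (N R ^ ((1 - κ) / r) * ν R ^ (β / r) * J ^ (1 - 1 / r))) := by
            have : 0 ≤ 1 - 1 / r := by rw [sub_nonneg, div_le_one hr0]; exact hr.le
            gcongr
        _ = _ := by ring
    refine (le_rpow_of_le_mul_rpow hJfin (by positivity) hmain).trans_eq ?_
    rw [one_div_one_div]
    simp only [ENNReal.mul_rpow_of_nonneg _ _ hr0.le, ← ENNReal.rpow_mul,
      div_mul_cancel₀ _ hr0.ne']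

open Classical in
/-- The testing inequality for a sparse family. -/
lemma exists_testing_const {γ a m : ℝ} (hγ : 0 < γ) (hγ1 : γ < 1) (ha : 0 < a) (ha1 : a < 1)
    (hm : 1 < m) (ham : 1 ≤ a * m) {e : ℝ} (he : e = a - 1 / m) :
    ∃ C : ℝ≥0∞, C ≠ ⊤ ∧ ∀ {α : Type*} [MeasurableSpace α] {T : Finset (Set α)}
      {E : Set α → Set α} {N ν μ : Measure α} {V : ℝ≥0∞}, TwoWeight T E N γ a ν μ V →
      ∀ {Y : ℝ≥0∞}, (∀ A ∈ T, ν A ≤ Y * ν (E A)) → ∀ {R : Set α}, (∀ A ∈ T, A ⊆ R) →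
      ∫⁻ x, famSum T (fracCoef N ν μ e) x ^ m ∂μ ≤ C * (V ^ m * Y * ν R ^ (a * m)) := by
  have hm0 : 0 < m := by linarith
  have he0 : 0 ≤ e := by
    rw [he, sub_nonneg, div_le_iff₀ hm0]; exact ham
  obtain ⟨κ, hκ⟩ : ∃ κ, e = a * κ := ⟨e / a, by field_simp⟩
  have hκ0 : 0 ≤ κ := by
    by_contra! hlt
    nlinarith
  obtain ⟨C, hC, hinner⟩ := exists_inner_const hγ hγ1 ha ha1 hm ham he hκ
  refine ⟨ENNReal.ofReal m * C, ENNReal.mul_ne_top ENNReal.ofReal_ne_top hC, ?_⟩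
  intro α _ T E N ν μ V h Y hY R hR
  set c := fracCoef N ν μ e with hc
  have hmeasF : ∀ A : Set α, Measurable fun x => famSum (T.filter (· ⊆ A)) c x ^ (m - 1) :=
    fun A => (measurable_famSum fun B hB =>
      h.sparse.meas B (Finset.filter_subset _ _ hB)).pow_const _
  calc ∫⁻ x, famSum T c x ^ m ∂μ
      ≤ ∫⁻ x, ENNReal.ofReal m * ∑ A ∈ T, A.indicator (fun _ => c A) x *
          famSum (T.filter (· ⊆ A)) c x ^ (m - 1) ∂μ :=
        lintegral_mono fun x => famSum_rpow_le h.sparse.nested hm.le x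
    _ = ENNReal.ofReal m * ∑ A ∈ T, ∫⁻ x, A.indicator (fun _ => c A) x *
          famSum (T.filter (· ⊆ A)) c x ^ (m - 1) ∂μ := by
        rw [lintegral_const_mul, lintegral_finsetSum]
        · exact fun A hA => (measurable_const.indicator (h.sparse.meas A hA)).mul (hmeasF A)
        · exact Finset.measurable_fun_sum _ fun A hA =>
            (measurable_const.indicator (h.sparse.meas A hA)).mul (hmeasF A)
    _ ≤ ENNReal.ofReal m * ∑ A ∈ T, C * (V ^ m * ν A ^ (a * m)) := by
        gcongr with A hA
        calc ∫⁻ x, A.indicator (fun _ => c A) x * famSum (T.filter (· ⊆ A)) c x ^ (m - 1) ∂μ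
            ≤ ∫⁻ x, c A * famSum (T.filter (· ⊆ A)) c x ^ (m - 1) ∂μ := by
              refine lintegral_mono fun x => ?_
              gcongr
              exact indicator_le_self _ _ x
          _ = c A * ∫⁻ x, famSum (T.filter (· ⊆ A)) c x ^ (m - 1) ∂μ :=
              lintegral_const_mul _ (hmeasF A)
          _ ≤ c A * (C * (V ^ (m - κ) *
                (ν A ^ (a * m - 1 + κ * (1 - a)) * N A ^ (1 - κ)))) := by
              gcongr
              exact hinner (h.mono (Finset.filter_subset _ _))
                fun B hB => (Finset.mem_filter.1 hB).2
          _ = C * (c A * (V ^ (m - κ) *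
                (ν A ^ (a * m - 1 + κ * (1 - a)) * N A ^ (1 - κ)))) := by ring
          _ ≤ _ := by
              gcongr C * ?_
              exact h.coef_mul_le hκ0 hκ hA
    _ = ENNReal.ofReal m * C * V ^ m * ∑ A ∈ T, ν A ^ (a * m) := by
        rw [← Finset.mul_sum, ← Finset.mul_sum]; ring
    _ ≤ ENNReal.ofReal m * C * V ^ m * ∑ A ∈ T, (Y * ν (E A)) * ν R ^ (a * m - 1) := by
        gcongr with A hA
        have : a * m = 1 + (a * m - 1) := by ring
        rw [this, ENNReal.rpow_add _ _ (h.ν_pos A hA) (h.ν_fin A hA), ENNReal.rpow_one,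
          add_sub_cancel_left]
        gcongr
        · exact hY A hA
        · exact hR A hA
    _ = ENNReal.ofReal m * C * V ^ m * (Y * ν R ^ (a * m - 1) * ∑ A ∈ T, ν (E A)) := by
        rw [Finset.mul_sum (a := Y * ν R ^ (a * m - 1))]
        congr 1
        exact Finset.sum_congr rfl fun A _ => by ring
    _ ≤ ENNReal.ofReal m * C * V ^ m * (Y * ν R ^ (a * m - 1) * ν R) := by
        gcongr
        exact sum_measure_le_of_disjoint T E h.sparse.measE h.sparse.disj ν
          fun A hA => (h.sparse.sub A hA).trans (hR A hA)
    _ = ENNReal.ofReal m * C * V ^ m * (Y * ν R ^ (a * m)) := by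
        have : ν R ^ (a * m) = ν R ^ (a * m - 1) * ν R := by
          conv_rhs => rw [← ENNReal.rpow_one (ν R), ← ENNReal.rpow_mul, one_mul]
          rw [← ENNReal.rpow_add_of_nonneg _ _ (by linarith) zero_le_one, sub_add_cancel]
        rw [this]; ring
    _ = _ := by ring

/-! ### Stopping families -/

/-- The average of `f` over `A` with respect to `μ`. -/
def wav {α : Type*} [MeasurableSpace α] (μ : Measure α) (f : α → ℝ≥0∞) (A : Set α) : ℝ≥0∞ :=
  (∫⁻ x in A, f x ∂μ) / μ A

lemma exists_stopping {α : Type*} (T : Finset (Set α)) (lev : Set α → ℤ) :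
    ∃ (F : Finset (Set α)) (par : Set α → Set α), F ⊆ T ∧
      (∀ A ∈ F, ∀ B ∈ F, A ⊂ B → lev B < lev A) ∧
      ∀ Q ∈ T, par Q ∈ F ∧ Q ⊆ par Q ∧ ∀ B ∈ T, Q ⊆ B → lev B ≤ lev (par Q) := by
  classical
  set F := T.filter fun A => ∀ B ∈ T, A ⊂ B → lev B < lev A with hF
  have key : ∀ Q, ∃ P, Q ∈ T → P ∈ F ∧ Q ⊆ P ∧ ∀ B ∈ T, Q ⊆ B → lev B ≤ lev P := by
    intro Q
    by_cases hQ : Q ∈ T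
    swap
    · exact ⟨Q, fun h => absurd h hQ⟩
    obtain ⟨M, hM, hmax⟩ := Finset.exists_max_image (T.filter (Q ⊆ ·)) lev
      ⟨Q, Finset.mem_filter.2 ⟨hQ, subset_rfl⟩⟩
    obtain ⟨P, -, hP⟩ := Finset.exists_le_maximal
      ((T.filter (Q ⊆ ·)).filter fun B => lev B = lev M)
      (Finset.mem_filter.2 ⟨hM, rfl⟩)
    obtain ⟨hP1, hPM⟩ := Finset.mem_filter.1 hP.1
    obtain ⟨hPT, hQP⟩ := Finset.mem_filter.1 hP1
    refine ⟨P, fun _ => ⟨Finset.mem_filter.2 ⟨hPT, fun B hB hPB => ?_⟩, hQP, fun B hB hQB => ?_⟩⟩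
    · have hB' : B ∈ T.filter (Q ⊆ ·) := Finset.mem_filter.2 ⟨hB, hQP.trans hPB.1⟩
      refine lt_of_le_of_ne (hPM ▸ hmax B hB') fun heq => hPB.2 ?_
      exact hP.2 (Finset.mem_filter.2 ⟨hB', heq.trans hPM⟩) hPB.1
    · exact hPM ▸ hmax B (Finset.mem_filter.2 ⟨hB, hQB⟩)
  choose par hpar using key
  exact ⟨F, par, Finset.filter_subset _ _,
    fun A hA B hB hAB => (Finset.mem_filter.1 hA).2 B (Finset.mem_filter.1 hB).1 hAB, hpar⟩

/-- A geometric sum over distinct levels. -/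
lemma sum_rpow_level_le {ι : Type*} (s : Finset ι) (l : ι → ℤ) (hinj : Set.InjOn l s)
    {L : ℤ} (hL : ∀ i ∈ s, l i ≤ L) {t : ℝ} :
    ∑ i ∈ s, ((2 : ℝ≥0∞) ^ (l i : ℝ)) ^ t ≤
      ((2 : ℝ≥0∞) ^ (L : ℝ)) ^ t * (1 - (2 : ℝ≥0∞) ^ (-t))⁻¹ := by
  have h1 : ∀ i ∈ s, ((2 : ℝ≥0∞) ^ (l i : ℝ)) ^ t =
      ((2 : ℝ≥0∞) ^ (L : ℝ)) ^ t * ((2 : ℝ≥0∞) ^ (-t)) ^ (L - l i).toNat := by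
    intro i hi
    have h2 : (((L - l i).toNat : ℕ) : ℝ) = L - l i := by
      have := Int.toNat_of_nonneg (sub_nonneg.2 (hL i hi))
      have h3 : ((((L - l i).toNat : ℕ) : ℤ) : ℝ) = ((L - l i : ℤ) : ℝ) := by rw [this]
      push_cast at h3
      exact h3
    rw [← ENNReal.rpow_natCast, h2]
    simp only [← ENNReal.rpow_mul]
    rw [← ENNReal.rpow_add _ _ two_ne_zero ENNReal.ofNat_ne_top]
    congr 1; ring
  rw [Finset.sum_congr rfl h1, ← Finset.mul_sum, ← ENNReal.tsum_geometric]
  gcongr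
  have hinj' : Set.InjOn (fun i => (L - l i).toNat) s := by
    intro i hi j hj hij
    have a1 := hL i hi
    have a2 := hL j hj
    simp only at hij
    exact hinj hi hj (by omega)
  rw [← Finset.sum_image (f := fun n => ((2 : ℝ≥0∞) ^ (-t)) ^ n) hinj']
  exact ENNReal.sum_le_tsum _

lemma famSum_level_le {α : Type*} {F : Finset (Set α)}
    (hF : ∀ A ∈ F, ∀ B ∈ F, A ⊆ B ∨ B ⊆ A ∨ Disjoint A B) {lev : Set α → ℤ}
    (hlev : ∀ A ∈ F, ∀ B ∈ F, A ⊂ B → lev B < lev A) {v : Set α → ℝ≥0∞}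
    (hv1 : ∀ A ∈ F, (2 : ℝ≥0∞) ^ (lev A : ℝ) ≤ v A)
    (hv2 : ∀ A ∈ F, v A ≤ 2 * (2 : ℝ≥0∞) ^ (lev A : ℝ)) {p : ℝ} (hp : 1 < p) (x : α) :
    famSum F (fun A => v A ^ (p - 1)) x ≤
      (2 ^ (p - 1) * (1 - (2 : ℝ≥0∞) ^ (-(p - 1)))⁻¹) *
        famSum F (fun A => v A ^ p) x ^ (1 - 1 / p) := by
  classical
  have hp1 : 0 < p - 1 := by linarith
  set s := F.filter (x ∈ ·) with hs
  have e : ∀ φ : Set α → ℝ≥0∞, famSum F φ x = ∑ A ∈ s, φ A := by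
    intro φ
    rw [famSum, hs, Finset.sum_filter]
    refine Finset.sum_congr rfl fun A _ => ?_
    by_cases hx : x ∈ A <;> simp [hx]
  rw [e, e]
  rcases s.eq_empty_or_nonempty with h0 | hne
  · simp [h0]
  obtain ⟨M, hM, hmax⟩ := Finset.exists_max_image s lev hne
  have hsF : ∀ A ∈ s, A ∈ F ∧ x ∈ A := fun A hA => by simpa [hs] using hA
  have hinj : Set.InjOn lev s := by
    intro A hA B hB hAB
    obtain ⟨hA1, hA2⟩ := hsF A hA
    obtain ⟨hB1, hB2⟩ := hsF B hB
    by_contra hne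
    rcases hF A hA1 B hB1 with h1 | h1 | h1
    · exact (hlev A hA1 B hB1 (h1.ssubset_of_ne hne)).ne' hAB
    · exact (hlev B hB1 A hA1 (h1.ssubset_of_ne (Ne.symm hne))).ne hAB
    · exact disjoint_left.1 h1 hA2 hB2
  calc ∑ A ∈ s, v A ^ (p - 1)
      ≤ ∑ A ∈ s, (2 * (2 : ℝ≥0∞) ^ (lev A : ℝ)) ^ (p - 1) := by
        gcongr with A hA
        exact hv2 A (hsF A hA).1
    _ = 2 ^ (p - 1) * ∑ A ∈ s, ((2 : ℝ≥0∞) ^ (lev A : ℝ)) ^ (p - 1) := by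
        rw [Finset.mul_sum]
        exact Finset.sum_congr rfl fun A _ => ENNReal.mul_rpow_of_nonneg _ _ hp1.le
    _ ≤ 2 ^ (p - 1) * (((2 : ℝ≥0∞) ^ (lev M : ℝ)) ^ (p - 1) *
          (1 - (2 : ℝ≥0∞) ^ (-(p - 1)))⁻¹) := by
        gcongr
        exact sum_rpow_level_le s lev hinj hmax
    _ = 2 ^ (p - 1) * (1 - (2 : ℝ≥0∞) ^ (-(p - 1)))⁻¹ *
          (((2 : ℝ≥0∞) ^ (lev M : ℝ)) ^ p) ^ (1 - 1 / p) := by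
        have : p * (1 - 1 / p) = p - 1 := by field_simp
        rw [← ENNReal.rpow_mul _ p, this]
        ring
    _ ≤ _ := by
        have : 0 ≤ 1 - 1 / p := by
          rw [sub_nonneg, div_le_one (by linarith)]; exact hp.le
        gcongr
        refine (ENNReal.rpow_le_rpow (hv1 M (hsF M hM).1) (by linarith)).trans ?_
        exact Finset.single_le_sum (f := fun A => v A ^ p) (fun _ _ => zero_le) hM

section Stopping

variable {α : Type*} [MeasurableSpace α] {F : Finset (Set α)}

lemma lintegral_mul_le_rpow (μ : Measure α) {f g : α → ℝ≥0∞} (hf : AEMeasurable f μ)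
    (hg : AEMeasurable g μ) {p q : ℝ} (hpq : p.HolderConjugate q) :
    ∫⁻ x, f x * g x ∂μ ≤ (∫⁻ x, f x ^ p ∂μ) ^ (1 / p) * (∫⁻ x, g x ^ q ∂μ) ^ (1 / q) :=
  ENNReal.lintegral_mul_le_Lp_mul_Lq μ hpq hf hg

/-- Carleson's embedding theorem for a stopping family. -/
lemma sum_wav_rpow_mul_le (hm : ∀ A ∈ F, MeasurableSet A)
    (hF : ∀ A ∈ F, ∀ B ∈ F, A ⊆ B ∨ B ⊆ A ∨ Disjoint A B) {lev : Set α → ℤ}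
    (hlev : ∀ A ∈ F, ∀ B ∈ F, A ⊂ B → lev B < lev A) {σ : Measure α} {H : α → ℝ≥0∞}
    (hH : Measurable H) (hσ0 : ∀ A ∈ F, σ A ≠ 0) (hσ : ∀ A ∈ F, σ A ≠ ⊤)
    (hv1 : ∀ A ∈ F, (2 : ℝ≥0∞) ^ (lev A : ℝ) ≤ wav σ H A)
    (hv2 : ∀ A ∈ F, wav σ H A ≤ 2 * (2 : ℝ≥0∞) ^ (lev A : ℝ)) {p : ℝ} (hp : 1 < p) :
    ∑ A ∈ F, wav σ H A ^ p * σ A ≤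
      (2 ^ (p - 1) * (1 - (2 : ℝ≥0∞) ^ (-(p - 1)))⁻¹) ^ p * ∫⁻ x, H x ^ p ∂σ := by
  have hp0 : 0 < p := by linarith
  set C := 2 ^ (p - 1) * (1 - (2 : ℝ≥0∞) ^ (-(p - 1)))⁻¹ with hC
  have hv0 : ∀ A ∈ F, wav σ H A ≠ 0 := fun A hA h0 => by
    have := hv1 A hA
    rw [h0, nonpos_iff_eq_zero, ENNReal.rpow_eq_zero_iff] at this
    simp at this
  have hvt : ∀ A ∈ F, wav σ H A ≠ ⊤ := fun A hA =>
    ne_top_of_le_ne_top (ENNReal.mul_ne_top ENNReal.ofNat_ne_top (by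
      rw [Ne, ENNReal.rpow_eq_top_iff]; simp)) (hv2 A hA)
  have hconj : p.HolderConjugate (p / (p - 1)) := Real.HolderConjugate.conjExponent hp
  have hfin : ∑ A ∈ F, wav σ H A ^ p * σ A ≠ ⊤ := ENNReal.sum_ne_top.2 fun A hA =>
    ENNReal.mul_ne_top (ENNReal.rpow_ne_top_of_nonneg hp0.le (hvt A hA)) (hσ A hA)
  have hmain : ∑ A ∈ F, wav σ H A ^ p * σ A ≤ (C * (∫⁻ x, H x ^ p ∂σ) ^ (1 / p)) *
      (∑ A ∈ F, wav σ H A ^ p * σ A) ^ (1 - 1 / p) := by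
    have hint : ∫⁻ x, famSum F (fun A => wav σ H A ^ p) x ∂σ = ∑ A ∈ F, wav σ H A ^ p * σ A := by
      have := lintegral_famSum_mul (c := fun A => wav σ H A ^ p) hm
        (measurable_const (a := (1 : ℝ≥0∞))) σ
      simpa using this
    calc ∑ A ∈ F, wav σ H A ^ p * σ A
        = ∑ A ∈ F, wav σ H A ^ (p - 1) * ∫⁻ x in A, H x ∂σ := by
          refine Finset.sum_congr rfl fun A hA => ?_
          have h1 : wav σ H A * σ A = ∫⁻ x in A, H x ∂σ := by
            rw [wav, ENNReal.div_mul_cancel (hσ0 A hA) (hσ A hA)]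
          have h2 : p = (p - 1) + 1 := by ring
          rw [← h1, ← mul_assoc]
          congr 1
          conv_lhs => rw [h2]
          rw [ENNReal.rpow_add _ _ (hv0 A hA) (hvt A hA), ENNReal.rpow_one]
      _ = ∫⁻ x, famSum F (fun A => wav σ H A ^ (p - 1)) x * H x ∂σ :=
          (lintegral_famSum_mul hm hH σ).symm
      _ ≤ ∫⁻ x, C * (H x * famSum F (fun A => wav σ H A ^ p) x ^ (1 - 1 / p)) ∂σ := by
          refine lintegral_mono fun x => ?_
          calc _ ≤ C * famSum F (fun A => wav σ H A ^ p) x ^ (1 - 1 / p) * H x := by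
                gcongr
                exact famSum_level_le hF hlev hv1 hv2 hp x
            _ = _ := by ring
      _ = C * ∫⁻ x, H x * famSum F (fun A => wav σ H A ^ p) x ^ (1 - 1 / p) ∂σ := by
          exact lintegral_const_mul _ (hH.mul ((measurable_famSum hm).pow_const _))
      _ ≤ C * ((∫⁻ x, H x ^ p ∂σ) ^ (1 / p) *
            (∫⁻ x, (famSum F (fun A => wav σ H A ^ p) x ^ (1 - 1 / p)) ^ (p / (p - 1)) ∂σ) ^
              (1 / (p / (p - 1)))) := by
          gcongr
          exact lintegral_mul_le_rpow σ hH.aemeasurable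
            ((measurable_famSum hm).pow_const _).aemeasurable hconj
      _ = _ := by
          have h3 : (1 - 1 / p) * (p / (p - 1)) = 1 := by
            have : p - 1 ≠ 0 := by linarith
            field_simp
          have h4 : 1 / (p / (p - 1)) = 1 - 1 / p := by
            have : p - 1 ≠ 0 := by linarith
            field_simp
          simp only [← ENNReal.rpow_mul, h3, ENNReal.rpow_one]
          rw [h4, hint]; ring
  refine (le_rpow_of_le_mul_rpow hfin (by positivity) hmain).trans_eq ?_
  rw [one_div_one_div, ENNReal.mul_rpow_of_nonneg _ _ hp0.le, ← ENNReal.rpow_mul,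
    one_div_mul_cancel hp0.ne', ENNReal.rpow_one]

open Classical in
/-- The maximal members of `F` strictly contained in `A`. -/
def children {α : Type*} (F : Finset (Set α)) (A : Set α) : Finset (Set α) :=
  (F.filter (· ⊂ A)).filter fun B => Maximal (· ∈ F.filter (· ⊂ A)) B

lemma mem_of_mem_children {α : Type*} {F : Finset (Set α)} {A B : Set α} (h : B ∈ children F A) :
    B ∈ F ∧ B ⊂ A := by
  classical
  simp only [children, Finset.mem_filter] at h
  exact h.1

lemma pairwiseDisjoint_children {α : Type*} {F : Finset (Set α)}
    (hF : ∀ A ∈ F, ∀ B ∈ F, A ⊆ B ∨ B ⊆ A ∨ Disjoint A B) (A : Set α) :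
    (children F A : Set (Set α)).PairwiseDisjoint id := by
  classical
  exact pairwiseDisjoint_maximal fun B hB D hD =>
    hF B (Finset.mem_filter.1 hB).1 D (Finset.mem_filter.1 hD).1

lemma exists_mem_children {α : Type*} {F : Finset (Set α)} {A B : Set α} (hB : B ∈ F)
    (hBA : B ⊂ A) : ∃ D ∈ children F A, B ⊆ D := by
  classical
  obtain ⟨D, hBD, hD⟩ := Finset.exists_le_maximal (F.filter (· ⊂ A))
    (Finset.mem_filter.2 ⟨hB, hBA⟩)
  exact ⟨D, Finset.mem_filter.2 ⟨hD.1, hD⟩, hBD⟩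

lemma disjoint_children {α : Type*} {F : Finset (Set α)}
    (hF : ∀ A ∈ F, ∀ B ∈ F, A ⊆ B ∨ B ⊆ A ∨ Disjoint A B) (hne : ∀ A ∈ F, A.Nonempty) :
    (F : Set (Set α)).PairwiseDisjoint (children F) := by
  classical
  have aux : ∀ A ∈ F, ∀ B ∈ F, A ⊂ B → ∀ D, D ∈ children F A → D ∉ children F B := by
    intro A hA B hB hAB D hDA hDB
    obtain ⟨hDF, hsub⟩ := mem_of_mem_children hDA
    have hmax := (Finset.mem_filter.1 hDB).2
    exact hsub.2 (hmax.2 (Finset.mem_filter.2 ⟨hA, hAB⟩) hsub.1)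
  intro A hA B hB hAB
  rw [Function.onFun, Finset.disjoint_left]
  intro D hDA hDB
  obtain ⟨hDF, hA'⟩ := mem_of_mem_children hDA
  obtain ⟨-, hB'⟩ := mem_of_mem_children hDB
  obtain ⟨x, hx⟩ := hne D hDF
  rcases hF A hA B hB with h | h | h
  · exact aux A hA B hB (h.ssubset_of_ne hAB) D hDA hDB
  · exact aux B hB A hA (h.ssubset_of_ne hAB.symm) D hDB hDA
  · exact disjoint_left.1 h (hA'.1 hx) (hB'.1 hx)

lemma pairwiseDisjoint_sdiff_children {α : Type*} {F : Finset (Set α)}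
    (hF : ∀ A ∈ F, ∀ B ∈ F, A ⊆ B ∨ B ⊆ A ∨ Disjoint A B) :
    (F : Set (Set α)).PairwiseDisjoint fun A => A \ ⋃ B ∈ children F A, B := by
  have aux : ∀ A ∈ F, ∀ B : Set α, A ⊂ B → ∀ x ∈ A, x ∉ B \ ⋃ D ∈ children F B, D := by
    intro A hA B hAB x hx hxB
    obtain ⟨D, hD, hAD⟩ := exists_mem_children hA hAB
    exact hxB.2 (mem_biUnion hD (hAD hx))
  intro A hA B hB hAB
  rw [Function.onFun, disjoint_left]
  intro x hxA hxB
  rcases hF A hA B hB with h | h | h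
  · exact aux A hA B (h.ssubset_of_ne hAB) x hxA.1 hxB
  · exact aux B hB A (h.ssubset_of_ne hAB.symm) x hxB.1 hxA
  · exact disjoint_left.1 h hxA.1 hxB.1

lemma sum_lintegral_le_of_disjoint (T : Finset (Set α)) (D : Set α → Set α)
    (hm : ∀ A ∈ T, MeasurableSet (D A)) (hd : (T : Set (Set α)).PairwiseDisjoint D)
    (μ : Measure α) (g : α → ℝ≥0∞) {R : Set α} (hR : ∀ A ∈ T, D A ⊆ R) :
    ∑ A ∈ T, ∫⁻ x in D A, g x ∂μ ≤ ∫⁻ x in R, g x ∂μ := by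
  rw [← lintegral_biUnion_finset hd hm]
  exact lintegral_mono_set (iUnion₂_subset hR)

/-- Duality estimate for a function supported in `A` and constant on the stopping children
of `A`. -/
lemma lintegral_mul_le_children (hm : ∀ A ∈ F, MeasurableSet A)
    (hF : ∀ A ∈ F, ∀ B ∈ F, A ⊆ B ∨ B ⊆ A ∨ Disjoint A B) {w : Measure α}
    (hw0 : ∀ A ∈ F, w A ≠ 0) (hw : ∀ A ∈ F, w A ≠ ⊤) {g f : α → ℝ≥0∞} (hg : Measurable g)
    (hf : Measurable f) {A : Set α} (hA : A ∈ F) (hfA : ∀ x ∉ A, f x = 0)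
    (hconst : ∀ B ∈ children F A, ∃ t, ∀ x ∈ B, f x = t) {q r : ℝ} (hqr : q.HolderConjugate r) :
    ∫⁻ x, f x * g x ∂w ≤ (∫⁻ x, f x ^ q ∂w) ^ (1 / q) *
      ((∫⁻ x in A \ ⋃ B ∈ children F A, B, g x ^ r ∂w) ^ (1 / r) +
        (∑ B ∈ children F A, wav w g B ^ r * w B) ^ (1 / r)) := by
  classical
  have hmU : MeasurableSet (⋃ B ∈ children F A, B) :=
    Finset.measurableSet_biUnion _ fun B hB => hm B (mem_of_mem_children hB).1
  set U := ⋃ B ∈ children F A, B with hU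
  have hUA : U ⊆ A := iUnion₂_subset fun B hB => (mem_of_mem_children hB).2.1
  have hd := pairwiseDisjoint_children hF A
  have hmch : ∀ B ∈ children F A, MeasurableSet B := fun B hB => hm B (mem_of_mem_children hB).1
  have hsplit : ∫⁻ x, f x * g x ∂w = ∫⁻ x in A \ U, f x * g x ∂w +
      ∑ B ∈ children F A, ∫⁻ x in B, f x * g x ∂w := by
    have h1 : ∫⁻ x, f x * g x ∂w = ∫⁻ x in A, f x * g x ∂w := by
      rw [← lintegral_indicator (hm A hA)]
      refine lintegral_congr fun x => ?_
      by_cases hx : x ∈ A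
      · simp [hx]
      · simp [hx, hfA x hx]
    have h2 : ∫⁻ x in U, f x * g x ∂w = ∑ B ∈ children F A, ∫⁻ x in B, f x * g x ∂w := by
      rw [hU]
      exact lintegral_biUnion_finset hd hmch _
    rw [h1, ← h2, ← lintegral_inter_add_sdiff (fun x => f x * g x) A hmU,
      inter_eq_self_of_subset_right hUA, add_comm]
  have hq0 : 0 < q := hqr.pos
  have hr0 : 0 < r := hqr.symm.pos
  have hsum : 1 / q + 1 / r = 1 := by simpa using hqr.inv_add_inv_eq_one
  have hfirst : ∫⁻ x in A \ U, f x * g x ∂w ≤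
      (∫⁻ x, f x ^ q ∂w) ^ (1 / q) * (∫⁻ x in A \ U, g x ^ r ∂w) ^ (1 / r) := by
    refine (lintegral_mul_le_rpow _ hf.aemeasurable hg.aemeasurable hqr).trans ?_
    gcongr
    exact Measure.restrict_le_self
  have hchild : ∀ B ∈ children F A, ∫⁻ x in B, f x * g x ∂w =
      (∫⁻ x in B, f x ^ q ∂w) ^ (1 / q) * (wav w g B ^ r * w B) ^ (1 / r) := by
    intro B hB
    obtain ⟨t, ht⟩ := hconst B hB
    have hBF := (mem_of_mem_children hB).1
    have h1 : ∫⁻ x in B, f x * g x ∂w = t * ∫⁻ x in B, g x ∂w := by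
      rw [← lintegral_const_mul _ hg]
      exact setLIntegral_congr_fun (hmch B hB) fun x hx => by simp only [ht x hx]
    have h2 : ∫⁻ x in B, f x ^ q ∂w = t ^ q * w B := by
      rw [← setLIntegral_const]
      exact setLIntegral_congr_fun (hmch B hB) fun x hx => by simp only [ht x hx]
    have h3 : wav w g B * w B = ∫⁻ x in B, g x ∂w := by
      rw [wav, ENNReal.div_mul_cancel (hw0 B hBF) (hw B hBF)]
    have h4 : w B ^ (1 / q) * w B ^ (1 / r) = w B := by
      rw [← ENNReal.rpow_add _ _ (hw0 B hBF) (hw B hBF), hsum, ENNReal.rpow_one]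
    rw [h1, h2, ENNReal.mul_rpow_of_nonneg _ _ (by positivity),
      ENNReal.mul_rpow_of_nonneg _ _ (by positivity), ← ENNReal.rpow_mul, ← ENNReal.rpow_mul,
      mul_one_div_cancel hq0.ne', mul_one_div_cancel hr0.ne', ENNReal.rpow_one, ENNReal.rpow_one,
      ← h3]
    calc t * (wav w g B * w B) = t * (wav w g B * (w B ^ (1 / q) * w B ^ (1 / r))) := by rw [h4]
      _ = _ := by ring
  have hsecond : ∑ B ∈ children F A, ∫⁻ x in B, f x * g x ∂w ≤
      (∫⁻ x, f x ^ q ∂w) ^ (1 / q) * (∑ B ∈ children F A, wav w g B ^ r * w B) ^ (1 / r) := by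
    rw [Finset.sum_congr rfl hchild]
    refine (sum_rpow_mul_rpow_le _ _ _ (by positivity) (by positivity) hsum.ge).trans ?_
    gcongr
    refine (sum_lintegral_le_of_disjoint (children F A) id hmch hd w (fun x => f x ^ q)
      fun B _ => subset_univ _).trans_eq ?_
    rw [Measure.restrict_univ]
  rw [hsplit, mul_add]
  exact add_le_add hfirst hsecond

lemma wav_ne_top {σ : Measure α} {H : α → ℝ≥0∞} (hH : Measurable H) {A : Set α}
    (h0 : σ A ≠ 0) (ht : σ A ≠ ⊤) {p : ℝ} (hp : 1 < p) (hfin : ∫⁻ x, H x ^ p ∂σ ≠ ⊤) :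
    wav σ H A ≠ ⊤ := by
  refine ENNReal.div_ne_top ?_ h0
  have h := lintegral_mul_le_rpow (σ.restrict A) hH.aemeasurable
    (measurable_const (a := (1 : ℝ≥0∞))).aemeasurable (Real.HolderConjugate.conjExponent hp)
  simp only [mul_one, ENNReal.one_rpow, lintegral_const, one_mul,
    Measure.restrict_apply_univ] at h
  refine ne_top_of_le_ne_top (ENNReal.mul_ne_top ?_ ?_) h
  · refine ENNReal.rpow_ne_top_of_nonneg (by positivity) (ne_top_of_le_ne_top hfin ?_)
    exact lintegral_mono' Measure.restrict_le_self le_rfl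
  · have := (Real.HolderConjugate.conjExponent hp).symm.pos
    exact ENNReal.rpow_ne_top_of_nonneg (by positivity) ht

lemma wav_level_const_ne_top {p : ℝ} (hp : 1 < p) :
    2 ^ (p - 1) * (1 - (2 : ℝ≥0∞) ^ (-(p - 1)))⁻¹ ≠ ⊤ := by
  refine ENNReal.mul_ne_top (ENNReal.rpow_ne_top_of_nonneg (by linarith) ENNReal.ofNat_ne_top) ?_
  have : (2 : ℝ≥0∞) ^ (-(p - 1)) < 1 :=
    ENNReal.rpow_lt_one_of_one_lt_of_neg (by norm_num) (by linarith)
  simpa using (tsub_pos_of_lt this).ne'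

open Classical in
/-- A one-sided form of the characterization of two-weight inequalities by testing: it suffices
to test on one side when the averages of `H` dominate those of `g`. -/
lemma sum_mul_wav_mul_le {T : Finset (Set α)} (hm : ∀ A ∈ T, MeasurableSet A)
    (hT : ∀ A ∈ T, ∀ B ∈ T, A ⊆ B ∨ B ⊆ A ∨ Disjoint A B) (hne : ∀ A ∈ T, A.Nonempty)
    {σ w : Measure α} (hσ0 : ∀ A ∈ T, σ A ≠ 0) (hσ : ∀ A ∈ T, σ A ≠ ⊤)
    (hw0 : ∀ A ∈ T, w A ≠ 0) (hw : ∀ A ∈ T, w A ≠ ⊤) {H g : α → ℝ≥0∞} (hH : Measurable H)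
    (hg : Measurable g) {p q r : ℝ} (hp : 1 < p) (hqr : q.HolderConjugate r)
    (hpr : 1 ≤ 1 / p + 1 / r) {h I : ℝ≥0∞} (hh : ∫⁻ x, H x ^ p ∂σ = h)
    (hI : ∫⁻ x, g x ^ r ∂w = I) (h0 : h ≠ 0) (ht : h ≠ ⊤)
    (hdom : ∀ A ∈ T, wav w g A ^ r * w A * h ≤ wav σ H A ^ p * σ A * I)
    {c : Set α → ℝ≥0∞} {τ : ℝ≥0∞}
    (htest : ∀ A ∈ T, ∫⁻ x, famSum (T.filter (· ⊆ A)) c x ^ q ∂w ≤ τ * σ A ^ (q / p))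
    {C : ℝ≥0∞} (hC : C = 2 ^ (p - 1) * (1 - (2 : ℝ≥0∞) ^ (-(p - 1)))⁻¹) :
    ∑ A ∈ T, c A * wav σ H A * ∫⁻ x in A, g x ∂w ≤
      2 * (C + C * (C ^ p) ^ (1 / r)) * (τ ^ (1 / q) * h ^ (1 / p) * I ^ (1 / r)) := by
  have hp0 : 0 < p := by linarith
  have hq0 : 0 < q := hqr.pos
  have hr0 : 0 < r := hqr.symm.pos
  have hlev : ∀ A, ∃ k : ℤ, A ∈ T → wav σ H A ≠ 0 →
      (2 : ℝ≥0∞) ^ (k : ℝ) ≤ wav σ H A ∧ wav σ H A ≤ 2 * (2 : ℝ≥0∞) ^ (k : ℝ) := by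
    intro A
    by_cases hA : A ∈ T ∧ wav σ H A ≠ 0
    swap
    · exact ⟨0, fun h1 h2 => absurd ⟨h1, h2⟩ hA⟩
    obtain ⟨k, hk1, hk2⟩ := ENNReal.exists_mem_Ico_zpow hA.2
      (wav_ne_top hH (hσ0 A hA.1) (hσ A hA.1) hp (hh ▸ ht)) (y := 2) (by norm_num)
      ENNReal.ofNat_ne_top
    refine ⟨k, fun _ _ => ⟨by rwa [ENNReal.rpow_intCast], ?_⟩⟩
    rw [ENNReal.rpow_intCast]
    rw [ENNReal.zpow_add two_ne_zero ENNReal.ofNat_ne_top, zpow_one, mul_comm] at hk2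
    exact hk2.le
  choose lev hlev using hlev
  set S := T.filter fun A => wav σ H A ≠ 0 with hS
  have hST : S ⊆ T := Finset.filter_subset _ _
  have hSmem : ∀ A ∈ S, A ∈ T ∧ wav σ H A ≠ 0 := fun A hA => Finset.mem_filter.1 hA
  obtain ⟨F, par, hFS, hFlev, hpar⟩ := exists_stopping S lev
  have hFT : F ⊆ T := hFS.trans hST
  have hv1 : ∀ A ∈ S, (2 : ℝ≥0∞) ^ (lev A : ℝ) ≤ wav σ H A := fun A hA =>
    (hlev A (hSmem A hA).1 (hSmem A hA).2).1
  have hv2 : ∀ A ∈ S, wav σ H A ≤ 2 * (2 : ℝ≥0∞) ^ (lev A : ℝ) := fun A hA =>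
    (hlev A (hSmem A hA).1 (hSmem A hA).2).2
  have hFn : ∀ A ∈ F, ∀ B ∈ F, A ⊆ B ∨ B ⊆ A ∨ Disjoint A B := fun A hA B hB =>
    hT A (hFT hA) B (hFT hB)
  have hFm : ∀ A ∈ F, MeasurableSet A := fun A hA => hm A (hFT hA)
  have hcarl : ∑ A ∈ F, wav σ H A ^ p * σ A ≤ C ^ p * h := by
    rw [hC, ← hh]
    exact sum_wav_rpow_mul_le hFm hFn hFlev hH (fun A hA => hσ0 A (hFT hA))
      (fun A hA => hσ A (hFT hA)) (fun A hA => hv1 A (hFS hA)) (fun A hA => hv2 A (hFS hA)) hp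
  set D := fun A => ∫⁻ x in A \ ⋃ B ∈ children F A, B, g x ^ r ∂w with hD
  set D' := fun A => ∑ B ∈ children F A, wav w g B ^ r * w B with hD'
  have hDsum : ∑ A ∈ F, D A ≤ I := by
    refine (sum_lintegral_le_of_disjoint F _ (fun A hA => ?_)
      (pairwiseDisjoint_sdiff_children hFn) w (fun x => g x ^ r)
      fun A _ => subset_univ _).trans_eq ?_
    · exact (hFm A hA).diff (Finset.measurableSet_biUnion _ fun B hB =>
        hFm B (mem_of_mem_children hB).1)
    · rw [Measure.restrict_univ, hI]
  have hD'sum : ∑ A ∈ F, D' A ≤ C ^ p * I := by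
    have h1 : ∑ A ∈ F, D' A ≤ ∑ B ∈ F, wav w g B ^ r * w B := by
      rw [hD', ← Finset.sum_biUnion (disjoint_children hFn fun A hA => hne A (hFT hA))]
      refine Finset.sum_le_sum_of_subset (Finset.biUnion_subset.2 fun A _ B hB => ?_)
      exact (mem_of_mem_children hB).1
    refine h1.trans ((ENNReal.mul_le_mul_iff_left h0 ht).1 ?_)
    calc (∑ B ∈ F, wav w g B ^ r * w B) * h
        = ∑ B ∈ F, wav w g B ^ r * w B * h := Finset.sum_mul _ _ _
      _ ≤ ∑ B ∈ F, wav σ H B ^ p * σ B * I :=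
          Finset.sum_le_sum fun B hB => hdom B (hFT hB)
      _ = (∑ B ∈ F, wav σ H B ^ p * σ B) * I := (Finset.sum_mul _ _ _).symm
      _ ≤ C ^ p * h * I := by gcongr
      _ = _ := by ring
  have hlocal : ∀ A ∈ F, ∑ Q ∈ S.filter (par · = A), c Q * ∫⁻ x in Q, g x ∂w ≤
      τ ^ (1 / q) * σ A ^ (1 / p) * (D A ^ (1 / r) + D' A ^ (1 / r)) := by
    intro A hA
    have hmem : ∀ Q ∈ S.filter (par · = A), Q ∈ S ∧ par Q = A := fun Q hQ => by
      simpa using hQ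
    have hsubA : ∀ Q ∈ S.filter (par · = A), Q ⊆ A := fun Q hQ => by
      obtain ⟨h1, h2⟩ := hmem Q hQ
      exact h2 ▸ (hpar Q h1).2.1
    have hmS : ∀ Q ∈ S.filter (par · = A), MeasurableSet Q := fun Q hQ =>
      hm Q (hST (hmem Q hQ).1)
    rw [← lintegral_famSum_mul hmS hg]
    refine (lintegral_mul_le_children hFm hFn (fun B hB => hw0 B (hFT hB))
      (fun B hB => hw B (hFT hB)) hg (measurable_famSum hmS) hA ?_ ?_ hqr).trans ?_
    · intro x hx
      exact Finset.sum_eq_zero fun Q hQ => indicator_of_notMem (fun h' => hx (hsubA Q hQ h')) _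
    · intro B hB
      obtain ⟨hBF, hBA⟩ := mem_of_mem_children hB
      refine ⟨∑ Q ∈ (S.filter (par · = A)).filter (B ⊆ ·), c Q, fun x hx => ?_⟩
      rw [famSum, Finset.sum_filter (fun Q => B ⊆ Q)]
      refine Finset.sum_congr rfl fun Q hQ => ?_
      obtain ⟨hQS, hQA⟩ := hmem Q hQ
      by_cases hBQ : B ⊆ Q
      · simp [hBQ, hBQ hx]
      · rw [if_neg hBQ, indicator_of_notMem]
        intro hxQ
        rcases hT B (hFT hBF) Q (hST hQS) with h1 | h1 | h1
        · exact hBQ h1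
        · have := (hpar Q hQS).2.2 B (hFS hBF) h1
          rw [hQA] at this
          exact absurd (hFlev B hBF A hA hBA) (not_lt.2 this)
        · exact disjoint_left.1 h1 hx hxQ
    · gcongr
      have : ∫⁻ x, famSum (S.filter (par · = A)) c x ^ q ∂w ≤ τ * σ A ^ (q / p) := by
        refine le_trans (lintegral_mono fun x => ?_) (htest A (hFT hA))
        refine ENNReal.rpow_le_rpow (famSum_mono (fun Q hQ => ?_) x) hq0.le
        exact Finset.mem_filter.2 ⟨hST (hmem Q hQ).1, hsubA Q hQ⟩
      refine (ENNReal.rpow_le_rpow this (by positivity)).trans_eq ?_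
      rw [ENNReal.mul_rpow_of_nonneg _ _ (by positivity), ← ENNReal.rpow_mul]
      congr 2
      field_simp
  have hpow : ∀ A ∈ F, wav σ H A * σ A ^ (1 / p) = (wav σ H A ^ p * σ A) ^ (1 / p) := by
    intro A _
    rw [ENNReal.mul_rpow_of_nonneg _ _ (by positivity), ← ENNReal.rpow_mul,
      mul_one_div_cancel hp0.ne', ENNReal.rpow_one]
  have hCh : (C ^ p * h) ^ (1 / p) = C * h ^ (1 / p) := by
    rw [ENNReal.mul_rpow_of_nonneg _ _ (by positivity), ← ENNReal.rpow_mul,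
      mul_one_div_cancel hp0.ne', ENNReal.rpow_one]
  have hHol : ∀ G : Set α → ℝ≥0∞, ∑ A ∈ F, (wav σ H A ^ p * σ A) ^ (1 / p) * G A ^ (1 / r) ≤
      C * h ^ (1 / p) * (∑ A ∈ F, G A) ^ (1 / r) := by
    intro G
    refine (sum_rpow_mul_rpow_le F _ G (by positivity) (by positivity) hpr).trans ?_
    rw [← hCh]
    gcongr
  calc ∑ A ∈ T, c A * wav σ H A * ∫⁻ x in A, g x ∂w
      = ∑ A ∈ S, c A * wav σ H A * ∫⁻ x in A, g x ∂w := by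
        refine (Finset.sum_subset hST fun A hA hAS => ?_).symm
        have : wav σ H A = 0 := by
          by_contra hne0
          exact hAS (Finset.mem_filter.2 ⟨hA, hne0⟩)
        rw [this, mul_zero, zero_mul]
    _ = ∑ A ∈ F, ∑ Q ∈ S.filter (par · = A), c Q * wav σ H Q * ∫⁻ x in Q, g x ∂w :=
        (Finset.sum_fiberwise_of_maps_to (fun Q hQ => (hpar Q hQ).1) _).symm
    _ ≤ ∑ A ∈ F, ∑ Q ∈ S.filter (par · = A), (2 * wav σ H A) * (c Q * ∫⁻ x in Q, g x ∂w) := by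
        refine Finset.sum_le_sum fun A hA => Finset.sum_le_sum fun Q hQ => ?_
        obtain ⟨hQS, hQA⟩ := Finset.mem_filter.1 hQ
        have h1 : wav σ H Q ≤ 2 * wav σ H A := by
          have hl := (hpar Q hQS).2.2 Q hQS subset_rfl
          rw [hQA] at hl
          refine (hv2 Q hQS).trans ?_
          gcongr
          refine le_trans ?_ (hv1 A (hFS hA))
          exact ENNReal.rpow_le_rpow_of_exponent_le (by norm_num) (by exact_mod_cast hl)
        calc _ = wav σ H Q * (c Q * ∫⁻ x in Q, g x ∂w) := by ring
          _ ≤ _ := by gcongr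
    _ = ∑ A ∈ F, 2 * wav σ H A * ∑ Q ∈ S.filter (par · = A), c Q * ∫⁻ x in Q, g x ∂w := by
        simp only [Finset.mul_sum]
    _ ≤ ∑ A ∈ F, 2 * wav σ H A *
          (τ ^ (1 / q) * σ A ^ (1 / p) * (D A ^ (1 / r) + D' A ^ (1 / r))) := by
        gcongr with A hA
        exact hlocal A hA
    _ = ∑ A ∈ F, 2 * τ ^ (1 / q) * ((wav σ H A ^ p * σ A) ^ (1 / p) * D A ^ (1 / r) +
          (wav σ H A ^ p * σ A) ^ (1 / p) * D' A ^ (1 / r)) := by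
        refine Finset.sum_congr rfl fun A hA => ?_
        rw [← hpow A hA]; ring
    _ = 2 * τ ^ (1 / q) * (∑ A ∈ F, (wav σ H A ^ p * σ A) ^ (1 / p) * D A ^ (1 / r) +
          ∑ A ∈ F, (wav σ H A ^ p * σ A) ^ (1 / p) * D' A ^ (1 / r)) := by
        rw [← Finset.mul_sum, Finset.sum_add_distrib]
    _ ≤ 2 * τ ^ (1 / q) * (C * h ^ (1 / p) * I ^ (1 / r) +
          C * h ^ (1 / p) * (C ^ p * I) ^ (1 / r)) := by
        gcongr
        · refine (hHol D).trans ?_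
          gcongr
        · refine (hHol D').trans ?_
          gcongr
    _ = _ := by
        rw [ENNReal.mul_rpow_of_nonneg _ _ (by positivity : 0 ≤ 1 / r)]; ring

end Stopping

/-! ### The bound for finite sparse families -/

section Assembly

variable {α : Type*} [MeasurableSpace α] {N σ w : Measure α} {q : ℝ} {W : ℝ≥0∞}

lemma measure_le_of_sparse {A B : Set α} (hBA : B ⊆ A) {γ : ℝ} (hγ : 0 < γ) (hq : 1 < q)
    (hN : ENNReal.ofReal γ * N A ≤ N B) (hA : w A * σ A ^ (q - 1) ≤ W * N A ^ q)
    (hB : N B ^ q ≤ w B * σ B ^ (q - 1)) (hw0 : w A ≠ 0) (hw : w A ≠ ⊤) (hσ0 : σ A ≠ 0)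
    (hσ : σ A ≠ ⊤) :
    w A ≤ (W * ENNReal.ofReal γ ^ (-q)) * w B ∧
      σ A ≤ (W * ENNReal.ofReal γ ^ (-q)) ^ (1 / (q - 1)) * σ B := by
  have hq1 : 0 < q - 1 := by linarith
  have hγ0 : ENNReal.ofReal γ ≠ 0 := by simpa using hγ
  set Z := W * ENNReal.ofReal γ ^ (-q) with hZ
  have hNA : N A ^ q ≤ ENNReal.ofReal γ ^ (-q) * N B ^ q := by
    calc N A ^ q = ENNReal.ofReal γ ^ (-q) * (ENNReal.ofReal γ * N A) ^ q := by
          rw [ENNReal.mul_rpow_of_nonneg _ _ (by linarith : 0 ≤ q), ← mul_assoc,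
            ← ENNReal.rpow_add _ _ hγ0 ENNReal.ofReal_ne_top, neg_add_cancel, ENNReal.rpow_zero,
            one_mul]
      _ ≤ _ := by gcongr
  have hmain : w A * σ A ^ (q - 1) ≤ Z * (w B * σ B ^ (q - 1)) := by
    calc w A * σ A ^ (q - 1) ≤ W * (ENNReal.ofReal γ ^ (-q) * (w B * σ B ^ (q - 1))) := by
          refine hA.trans ?_
          gcongr
          exact hNA.trans (by gcongr)
      _ = _ := by rw [hZ]; ring
  have hs0 : σ A ^ (q - 1) ≠ 0 := by simp [ENNReal.rpow_eq_zero_iff, hσ0, hσ]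
  have hst : σ A ^ (q - 1) ≠ ⊤ := ENNReal.rpow_ne_top_of_nonneg hq1.le hσ
  constructor
  · refine (ENNReal.mul_le_mul_iff_left hs0 hst).1 (hmain.trans ?_)
    calc Z * (w B * σ B ^ (q - 1)) ≤ Z * (w B * σ A ^ (q - 1)) := by gcongr
      _ = _ := by ring
  · have h1 : σ A ^ (q - 1) ≤ Z * σ B ^ (q - 1) := by
      refine (ENNReal.mul_le_mul_iff_right hw0 hw).1 (hmain.trans ?_)
      calc Z * (w B * σ B ^ (q - 1)) ≤ Z * (w A * σ B ^ (q - 1)) := by gcongr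
        _ = _ := by ring
    have h2 := ENNReal.rpow_le_rpow h1 (show 0 ≤ 1 / (q - 1) by positivity)
    rwa [ENNReal.mul_rpow_of_nonneg _ _ (by positivity), ← ENNReal.rpow_mul, ← ENNReal.rpow_mul,
      mul_one_div_cancel hq1.ne', ENNReal.rpow_one, ENNReal.rpow_one] at h2

/-- A pair of dual weights on a finite sparse family. -/
structure DualWeights (T : Finset (Set α)) (E : Set α → Set α) (N : Measure α) (γ q : ℝ)
    (σ w : Measure α) (W : ℝ≥0∞) : Prop where
  sparse : SparseNested T E N γ
  N_pos : ∀ A ∈ T, N A ≠ 0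
  σ_pos : ∀ A ∈ T, σ A ≠ 0
  σ_fin : ∀ A ∈ T, σ A ≠ ⊤
  w_pos : ∀ A ∈ T, w A ≠ 0
  w_fin : ∀ A ∈ T, w A ≠ ⊤
  one_le : 1 ≤ W
  W_fin : W ≠ ⊤
  le : ∀ A ∈ T, w A * σ A ^ (q - 1) ≤ W * N A ^ q
  le_sparse : ∀ A ∈ T, N (E A) ^ q ≤ w (E A) * σ (E A) ^ (q - 1)

variable {T : Finset (Set α)} {E : Set α → Set α} {γ : ℝ}

lemma DualWeights.mono {U : Finset (Set α)} (h : DualWeights T E N γ q σ w W) (hU : U ⊆ T) :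
    DualWeights U E N γ q σ w W where
  sparse := h.sparse.mono hU
  N_pos A hA := h.N_pos A (hU hA)
  σ_pos A hA := h.σ_pos A (hU hA)
  σ_fin A hA := h.σ_fin A (hU hA)
  w_pos A hA := h.w_pos A (hU hA)
  w_fin A hA := h.w_fin A (hU hA)
  one_le := h.one_le
  W_fin := h.W_fin
  le A hA := h.le A (hU hA)
  le_sparse A hA := h.le_sparse A (hU hA)

lemma DualWeights.muckenhoupt (h : DualWeights T E N γ q σ w W) (hq : 1 < q) {A : Set α}
    (hA : A ∈ T) : w A ^ (1 / q) * σ A ^ (1 - 1 / q) ≤ W ^ (1 / q) * N A := by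
  have hq0 : 0 < q := by linarith
  have := ENNReal.rpow_le_rpow (h.le A hA) (show 0 ≤ 1 / q by positivity)
  rw [ENNReal.mul_rpow_of_nonneg _ _ (by positivity), ENNReal.mul_rpow_of_nonneg _ _
    (by positivity), ← ENNReal.rpow_mul, ← ENNReal.rpow_mul, mul_one_div_cancel hq0.ne',
    ENNReal.rpow_one] at this
  have e : (q - 1) * (1 / q) = 1 - 1 / q := by field_simp
  rwa [e] at this

lemma DualWeights.W_rpow (h : DualWeights T E N γ q σ w W) (t : ℝ) :
    W ^ t ≠ 0 ∧ W ^ t ≠ ⊤ := by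
  have h0 : W ≠ 0 := (zero_lt_one.trans_le h.one_le).ne'
  simp [ENNReal.rpow_eq_zero_iff, ENNReal.rpow_eq_top_iff, h0, h.W_fin]

lemma DualWeights.twoWeight (h : DualWeights T E N γ q σ w W) (hq : 1 < q) :
    TwoWeight T E N γ (1 / q) σ w (W ^ (1 / q)) where
  sparse := h.sparse
  N_pos := h.N_pos
  ν_pos := h.σ_pos
  ν_fin := h.σ_fin
  μ_pos := h.w_pos
  μ_fin := h.w_fin
  V_pos := (h.W_rpow _).1
  V_fin := (h.W_rpow _).2
  le A hA := by rw [mul_comm]; exact h.muckenhoupt hq hA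

lemma DualWeights.twoWeight_dual (h : DualWeights T E N γ q σ w W) (hq : 1 < q) :
    TwoWeight T E N γ (1 - 1 / q) w σ (W ^ (1 / q)) where
  sparse := h.sparse
  N_pos := h.N_pos
  ν_pos := h.w_pos
  ν_fin := h.w_fin
  μ_pos := h.σ_pos
  μ_fin := h.σ_fin
  V_pos := (h.W_rpow _).1
  V_fin := (h.W_rpow _).2
  le A hA := by rw [_root_.sub_sub_cancel]; exact h.muckenhoupt hq hA

lemma DualWeights.sparse_le (h : DualWeights T E N γ q σ w W) (hγ : 0 < γ) (hq : 1 < q)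
    {A : Set α} (hA : A ∈ T) :
    w A ≤ (W * ENNReal.ofReal γ ^ (-q)) * w (E A) ∧
      σ A ≤ (W * ENNReal.ofReal γ ^ (-q)) ^ (1 / (q - 1)) * σ (E A) :=
  measure_le_of_sparse (h.sparse.sub A hA) hγ hq (h.sparse.le A hA) (h.le A hA)
    (h.le_sparse A hA) (h.w_pos A hA) (h.w_fin A hA) (h.σ_pos A hA) (h.σ_fin A hA)

open Classical in
/-- The testing condition on the side of `σ`. -/
lemma exists_testing_left {γ p q : ℝ} (hγ : 0 < γ) (hγ1 : γ < 1) (hp : 1 < p) (hpq : p ≤ q) :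
    ∃ C : ℝ≥0∞, C ≠ ⊤ ∧ ∀ {α : Type*} [MeasurableSpace α] {T : Finset (Set α)}
      {E : Set α → Set α} {N σ w : Measure α} {W : ℝ≥0∞}, DualWeights T E N γ q σ w W →
      ∀ A ∈ T, ∫⁻ x, famSum (T.filter (· ⊆ A)) (fracCoef N σ σ (1 / p - 1 / q)) x ^ q ∂w ≤
        C * (W * (W * ENNReal.ofReal γ ^ (-q)) ^ (1 / (q - 1))) * σ A ^ (q / p) := by
  have hp0 : 0 < p := by linarith
  have hq : 1 < q := by linarith
  have hq0 : 0 < q := by linarith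
  have he : 0 ≤ 1 / p - 1 / q := sub_nonneg.2 (one_div_le_one_div_of_le hp0 hpq)
  obtain ⟨C, hC, hT⟩ := exists_testing_const hγ hγ1 (a := 1 / q) (m := q) (by positivity)
    (by rw [div_lt_one hq0]; exact hq) hq (by rw [one_div_mul_cancel hq0.ne'])
    (e := 0) (by ring)
  refine ⟨C, hC, ?_⟩
  intro α _ T E N σ w W h A hA
  set X := (W * ENNReal.ofReal γ ^ (-q)) ^ (1 / (q - 1))
  have hU : T.filter (· ⊆ A) ⊆ T := Finset.filter_subset _ _
  have htest := hT ((h.mono hU).twoWeight hq) (Y := X)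
    (fun B hB => (h.sparse_le hγ hq (hU hB)).2) (R := A) fun B hB => (Finset.mem_filter.1 hB).2
  rw [one_div_mul_cancel hq0.ne', ENNReal.rpow_one, ← ENNReal.rpow_mul,
    one_div_mul_cancel hq0.ne', ENNReal.rpow_one] at htest
  have hpt : ∀ x, famSum (T.filter (· ⊆ A)) (fracCoef N σ σ (1 / p - 1 / q)) x ≤
      σ A ^ (1 / p - 1 / q) * famSum (T.filter (· ⊆ A)) (fracCoef N σ w 0) x := by
    intro x
    rw [famSum, famSum, Finset.mul_sum]
    refine Finset.sum_le_sum fun B hB => ?_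
    by_cases hx : x ∈ B
    · simp only [hx, indicator_of_mem, fracCoef, ENNReal.rpow_zero, one_mul, mul_div_assoc]
      gcongr
      exact (Finset.mem_filter.1 hB).2
    · simp [hx]
  calc ∫⁻ x, famSum (T.filter (· ⊆ A)) (fracCoef N σ σ (1 / p - 1 / q)) x ^ q ∂w
      ≤ ∫⁻ x, (σ A ^ (1 / p - 1 / q)) ^ q *
          famSum (T.filter (· ⊆ A)) (fracCoef N σ w 0) x ^ q ∂w := by
        refine lintegral_mono fun x => ?_
        rw [← ENNReal.mul_rpow_of_nonneg _ _ hq0.le]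
        exact ENNReal.rpow_le_rpow (hpt x) hq0.le
    _ = (σ A ^ (1 / p - 1 / q)) ^ q *
          ∫⁻ x, famSum (T.filter (· ⊆ A)) (fracCoef N σ w 0) x ^ q ∂w :=
        lintegral_const_mul _ ((measurable_famSum fun B hB =>
          h.sparse.meas B (hU hB)).pow_const _)
    _ ≤ (σ A ^ (1 / p - 1 / q)) ^ q * (C * (W * X * σ A)) := by gcongr
    _ = C * (W * X) * ((σ A ^ (1 / p - 1 / q)) ^ q * σ A) := by ring
    _ = C * (W * X) * σ A ^ (q / p) := by
        congr 1
        conv_lhs => rw [← ENNReal.rpow_mul, ← ENNReal.rpow_one (σ A), ← ENNReal.rpow_mul,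
          ← ENNReal.rpow_add _ _ (h.σ_pos A hA) (h.σ_fin A hA)]
        congr 1
        field_simp
        ring

open Classical in
/-- The testing condition on the side of `w`. -/
lemma exists_testing_right {γ p q : ℝ} (hγ : 0 < γ) (hγ1 : γ < 1) (hp : 1 < p) (hpq : p ≤ q) :
    ∃ C : ℝ≥0∞, C ≠ ⊤ ∧ ∀ {α : Type*} [MeasurableSpace α] {T : Finset (Set α)}
      {E : Set α → Set α} {N σ w : Measure α} {W : ℝ≥0∞}, DualWeights T E N γ q σ w W →
      ∀ A ∈ T, ∫⁻ x, famSum (T.filter (· ⊆ A)) (fracCoef N w σ (1 / p - 1 / q)) x ^ conj p ∂σ ≤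
        C * ((W ^ (1 / q)) ^ conj p * (W * ENNReal.ofReal γ ^ (-q))) *
          w A ^ (conj p / conj q) := by
  have hp0 : 0 < p := by linarith
  have hq : 1 < q := by linarith
  have hq0 : 0 < q := by linarith
  have hp1 : 0 < p - 1 := by linarith
  have hq1 : 0 < q - 1 := by linarith
  have hm : 1 < conj p := by rw [conj, lt_div_iff₀ hp1]; linarith
  have hinv : 1 / conj q = 1 - 1 / q := by rw [conj]; field_simp
  have hinvp : 1 / conj p = 1 - 1 / p := by rw [conj]; field_simp
  have ham : (1 - 1 / q) * conj p = conj p / conj q := by rw [← hinv]; ring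
  obtain ⟨C, hC, hT⟩ := exists_testing_const hγ hγ1 (a := 1 - 1 / q) (m := conj p)
    (by rw [sub_pos, div_lt_one hq0]; exact hq)
    (by have : 0 < 1 / q := by positivity
        linarith) hm
    (by
      have h1 : 1 / q ≤ 1 / p := one_div_le_one_div_of_le hp0 hpq
      have h2 : 1 / conj p * conj p = 1 := one_div_mul_cancel (by linarith)
      calc 1 = (1 - 1 / p) * conj p := by rw [← hinvp, h2]
        _ ≤ (1 - 1 / q) * conj p := by gcongr) (e := 1 / p - 1 / q) (by rw [hinvp]; ring)
  refine ⟨C, hC, ?_⟩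
  intro α _ T E N σ w W h A hA
  have hU : T.filter (· ⊆ A) ⊆ T := Finset.filter_subset _ _
  have htest := hT ((h.mono hU).twoWeight_dual hq) (Y := W * ENNReal.ofReal γ ^ (-q))
    (fun B hB => (h.sparse_le hγ hq (hU hB)).1) (R := A) fun B hB => (Finset.mem_filter.1 hB).2
  rw [ham] at htest
  exact htest.trans_eq (by ring)

end Assembly

section FiniteBound

lemma rpow_testing_left {C W G : ℝ≥0∞} {q m : ℝ} (hq : 1 < q) (hW : 1 ≤ W) (hWt : W ≠ ⊤)
    (hm : 1 / (q - 1) ≤ m) :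
    (C * (W * (W * G) ^ (1 / (q - 1)))) ^ (1 / q) ≤ (C * G ^ (1 / (q - 1))) ^ (1 / q) * W ^ m := by
  have hq1 : 0 < q - 1 := by linarith
  have hW0 : W ≠ 0 := (zero_lt_one.trans_le hW).ne'
  have h1 : C * (W * (W * G) ^ (1 / (q - 1))) =
      C * G ^ (1 / (q - 1)) * W ^ (1 + 1 / (q - 1)) := by
    rw [ENNReal.mul_rpow_of_nonneg _ _ (by positivity), ENNReal.rpow_add _ _ hW0 hWt,
      ENNReal.rpow_one]
    ring
  have e : (1 + 1 / (q - 1)) * (1 / q) = 1 / (q - 1) := by field_simp; ring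
  rw [h1, ENNReal.mul_rpow_of_nonneg _ _ (by positivity), ← ENNReal.rpow_mul, e]
  gcongr

lemma rpow_testing_right {C W G : ℝ≥0∞} {q r m : ℝ} (hr : 0 < r) (hW : 1 ≤ W) (hWt : W ≠ ⊤)
    (hm : 1 / r + 1 / q ≤ m) :
    (C * ((W ^ (1 / q)) ^ r * (W * G))) ^ (1 / r) ≤ (C * G) ^ (1 / r) * W ^ m := by
  have hW0 : W ≠ 0 := (zero_lt_one.trans_le hW).ne'
  have h1 : C * ((W ^ (1 / q)) ^ r * (W * G)) = C * G * W ^ (1 / q * r + 1) := by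
    rw [ENNReal.rpow_add _ _ hW0 hWt, ENNReal.rpow_one, ENNReal.rpow_mul]
    ring
  have e : (1 / q * r + 1) * (1 / r) = 1 / r + 1 / q := by field_simp; ring
  rw [h1, ENNReal.mul_rpow_of_nonneg _ _ (by positivity), ← ENNReal.rpow_mul, e]
  gcongr

lemma holderConjugate_conj {p : ℝ} (hp : 1 < p) : p.HolderConjugate (conj p) :=
  Real.HolderConjugate.conjExponent hp

open Classical in
/-- The weighted bound for a finite sparse family. -/
lemma exists_sparse_bound {γ p q : ℝ} (hγ : 0 < γ) (hγ1 : γ < 1) (hp : 1 < p) (hpq : p ≤ q) :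
    ∃ K : ℝ≥0∞, K ≠ ⊤ ∧ ∀ {α : Type*} [MeasurableSpace α] {T : Finset (Set α)}
      {E : Set α → Set α} {N σ w : Measure α} {W : ℝ≥0∞}, DualWeights T E N γ q σ w W →
      ∀ {H : α → ℝ≥0∞}, Measurable H →
      (∫⁻ x, famSum T (fun A => fracCoef N σ σ (1 / p - 1 / q) A * wav σ H A) x ^ q ∂w) ^ (1 / q) ≤
        K * W ^ max (1 / conj p + 1 / q) (1 / (q - 1)) * (∫⁻ x, H x ^ p ∂σ) ^ (1 / p) := by
  have hp0 : 0 < p := by linarith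
  have hq : 1 < q := by linarith
  have hq0 : 0 < q := by linarith
  have hpc := holderConjugate_conj hp
  have hqc := holderConjugate_conj hq
  have hpq' : 1 ≤ 1 / p + 1 / conj q := by
    have h1 : 1 / q ≤ 1 / p := one_div_le_one_div_of_le hp0 hpq
    have h2 := hqc.inv_add_inv_eq_one
    rw [one_div, one_div] at *
    linarith
  have hqp' : 1 ≤ 1 / conj q + 1 / p := by linarith
  obtain ⟨C₁, hC₁, htest₁⟩ := exists_testing_left hγ hγ1 hp hpq
  obtain ⟨C₂, hC₂, htest₂⟩ := exists_testing_right hγ hγ1 hp hpq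
  set G := ENNReal.ofReal γ ^ (-q)
  have hG : G ≠ ⊤ := by
    simp [G, ENNReal.rpow_eq_top_iff, hγ, not_lt.2 hq0.le]
  obtain ⟨D₁, hD₁⟩ : ∃ D : ℝ≥0∞, D = 2 ^ (p - 1) * (1 - (2 : ℝ≥0∞) ^ (-(p - 1)))⁻¹ := ⟨_, rfl⟩
  obtain ⟨D₂, hD₂⟩ : ∃ D : ℝ≥0∞,
    D = 2 ^ (conj q - 1) * (1 - (2 : ℝ≥0∞) ^ (-(conj q - 1)))⁻¹ := ⟨_, rfl⟩
  have hD₁t : D₁ ≠ ⊤ := hD₁ ▸ wav_level_const_ne_top hp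
  have hD₂t : D₂ ≠ ⊤ := hD₂ ▸ wav_level_const_ne_top hqc.symm.lt
  set K₁ := 2 * (D₁ + D₁ * (D₁ ^ p) ^ (1 / conj q)) * (C₁ * G ^ (1 / (q - 1))) ^ (1 / q)
  set K₂ := 2 * (D₂ + D₂ * (D₂ ^ conj q) ^ (1 / p)) * (C₂ * G) ^ (1 / conj p)
  have hK₁ : K₁ ≠ ⊤ := by
    have := hqc.symm.pos
    have : 0 < q - 1 := by linarith
    refine ENNReal.mul_ne_top (ENNReal.mul_ne_top (by simp) (ENNReal.add_ne_top.2 ⟨hD₁t,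
      ENNReal.mul_ne_top hD₁t ?_⟩)) (ENNReal.rpow_ne_top_of_nonneg (by positivity)
        (ENNReal.mul_ne_top hC₁ (ENNReal.rpow_ne_top_of_nonneg (by positivity) hG)))
    exact ENNReal.rpow_ne_top_of_nonneg (by positivity)
      (ENNReal.rpow_ne_top_of_nonneg (by positivity) hD₁t)
  have hK₂ : K₂ ≠ ⊤ := by
    have := hqc.symm.pos
    have := hpc.symm.pos
    refine ENNReal.mul_ne_top (ENNReal.mul_ne_top (by simp) (ENNReal.add_ne_top.2 ⟨hD₂t,
      ENNReal.mul_ne_top hD₂t ?_⟩)) (ENNReal.rpow_ne_top_of_nonneg (by positivity)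
        (ENNReal.mul_ne_top hC₂ hG))
    exact ENNReal.rpow_ne_top_of_nonneg (by positivity)
      (ENNReal.rpow_ne_top_of_nonneg (by positivity) hD₂t)
  refine ⟨K₁ + K₂ + 1, ENNReal.add_ne_top.2 ⟨ENNReal.add_ne_top.2 ⟨hK₁, hK₂⟩, by simp⟩, ?_⟩
  intro α _ T E N σ w W hDW H hH
  set m := max (1 / conj p + 1 / q) (1 / (q - 1))
  set c := fracCoef N σ σ (1 / p - 1 / q)
  set c' := fracCoef N w σ (1 / p - 1 / q)
  obtain ⟨h, hh⟩ : ∃ h, ∫⁻ x, H x ^ p ∂σ = h := ⟨_, rfl⟩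
  rw [hh]
  rcases eq_or_ne h ⊤ with rfl | ht
  · rw [ENNReal.top_rpow_of_pos (by positivity), ENNReal.mul_top]
    · exact le_top
    · exact mul_ne_zero (by simp) (hDW.W_rpow m).1
  have hwav : ∀ A ∈ T, c A * wav σ H A ≠ ⊤ := fun A hA =>
    ENNReal.mul_ne_top
      (ENNReal.div_ne_top (ENNReal.mul_ne_top (by
        simp [ENNReal.rpow_eq_top_iff, hDW.σ_pos A hA, hDW.σ_fin A hA]) (hDW.σ_fin A hA))
        (hDW.N_pos A hA))
      (wav_ne_top hH (hDW.σ_pos A hA) (hDW.σ_fin A hA) hp (hh ▸ ht))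
  set u := famSum T (fun A => c A * wav σ H A) with hu
  have hum : Measurable u := measurable_famSum hDW.sparse.meas
  obtain ⟨I, hI⟩ : ∃ I, ∫⁻ x, u x ^ q ∂w = I := ⟨_, rfl⟩
  have hIt : I ≠ ⊤ := hI ▸ lintegral_famSum_rpow_ne_top hDW.sparse.meas hwav hDW.w_fin hq0
  rw [hI]
  rcases eq_or_ne I 0 with rfl | hI0
  · rw [ENNReal.zero_rpow_of_pos (by positivity)]
    exact zero_le
  set g : α → ℝ≥0∞ := fun x => u x ^ (q - 1)
  have hg : Measurable g := hum.pow_const _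
  have hgI : ∫⁻ x, g x ^ conj q ∂w = I := by
    rw [← hI]
    refine lintegral_congr fun x => ?_
    rw [← ENNReal.rpow_mul, hqc.sub_one_mul_conj]
  have hsum : I = ∑ A ∈ T, c A * wav σ H A * ∫⁻ x in A, g x ∂w := by
    rw [← lintegral_famSum_mul hDW.sparse.meas hg, ← hI]
    refine lintegral_congr fun x => ?_
    change u x ^ q = u x * u x ^ (q - 1)
    conv_rhs => rw [← ENNReal.rpow_one (u x), ← ENNReal.rpow_mul]
    rw [← ENNReal.rpow_add_of_nonneg _ _ (by norm_num) (by linarith)]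
    congr 1; ring
  have h0 : h ≠ 0 := by
    rintro rfl
    apply hI0
    rw [hsum]
    refine Finset.sum_eq_zero fun A _ => ?_
    have hH0 : ∫⁻ x in A, H x ∂σ = 0 := by
      rw [lintegral_eq_zero_iff (hH.pow_const p)] at hh
      rw [lintegral_eq_zero_iff hH]
      refine ae_restrict_of_ae (hh.mono fun x hx => ?_)
      simpa [ENNReal.rpow_eq_zero_iff, hp0, not_lt.2 hp0.le] using hx
    simp [wav, hH0]
  set T₁ := T.filter fun A => wav w g A ^ conj q * w A * h ≤ wav σ H A ^ p * σ A * I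
  set T₂ := T.filter fun A => ¬ wav w g A ^ conj q * w A * h ≤ wav σ H A ^ p * σ A * I
  have hT₁ : T₁ ⊆ T := Finset.filter_subset _ _
  have hT₂ : T₂ ⊆ T := Finset.filter_subset _ _
  have h₁ := hDW.mono hT₁
  have h₂ := hDW.mono hT₂
  have b₁ := sum_mul_wav_mul_le h₁.sparse.meas h₁.sparse.nested h₁.sparse.nonempty h₁.σ_pos
    h₁.σ_fin h₁.w_pos h₁.w_fin hH hg hp hqc hpq' hh hgI h0 ht
    (fun A hA => (Finset.mem_filter.1 hA).2) (htest₁ h₁) hD₁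
  have b₂ := sum_mul_wav_mul_le h₂.sparse.meas h₂.sparse.nested h₂.sparse.nonempty h₂.w_pos
    h₂.w_fin h₂.σ_pos h₂.σ_fin hg hH hqc.symm.lt hpc.symm hqp' hgI hh hI0 hIt
    (fun A hA => (not_le.1 (Finset.mem_filter.1 hA).2).le) (htest₂ h₂) hD₂
  have hswap : ∑ A ∈ T₂, c A * wav σ H A * ∫⁻ x in A, g x ∂w =
      ∑ A ∈ T₂, c' A * wav w g A * ∫⁻ x in A, H x ∂σ := by
    refine Finset.sum_congr rfl fun A hA => ?_
    have e1 : ∫⁻ x in A, g x ∂w = wav w g A * w A :=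
      (ENNReal.div_mul_cancel (h₂.w_pos A hA) (h₂.w_fin A hA)).symm
    have e2 : ∫⁻ x in A, H x ∂σ = wav σ H A * σ A :=
      (ENNReal.div_mul_cancel (h₂.σ_pos A hA) (h₂.σ_fin A hA)).symm
    rw [e1, e2]
    simp only [c, c', fracCoef, ENNReal.div_eq_inv_mul]
    ring
  have hfin : I ≤ (K₁ + K₂) * W ^ m * h ^ (1 / p) * I ^ (1 - 1 / q) := by
    have e : 1 / conj q = 1 - 1 / q := by
      have := hqc.inv_add_inv_eq_one
      rw [one_div, one_div]; linarith
    calc I = ∑ A ∈ T₁, c A * wav σ H A * ∫⁻ x in A, g x ∂w +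
          ∑ A ∈ T₂, c A * wav σ H A * ∫⁻ x in A, g x ∂w := by
          rw [hsum, Finset.sum_filter_add_sum_filter_not]
      _ ≤ 2 * (D₁ + D₁ * (D₁ ^ p) ^ (1 / conj q)) * (((C₁ * G ^ (1 / (q - 1))) ^ (1 / q) * W ^ m) *
            h ^ (1 / p) * I ^ (1 / conj q)) +
          2 * (D₂ + D₂ * (D₂ ^ conj q) ^ (1 / p)) * (((C₂ * G) ^ (1 / conj p) * W ^ m) *
            I ^ (1 / conj q) * h ^ (1 / p)) := by
          rw [hswap]
          refine add_le_add (b₁.trans ?_) (b₂.trans ?_)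
          · gcongr
            exact rpow_testing_left hq hDW.one_le hDW.W_fin (le_max_right _ _)
          · gcongr
            exact rpow_testing_right hpc.symm.pos hDW.one_le hDW.W_fin (le_max_left _ _)
      _ = (K₁ + K₂) * W ^ m * h ^ (1 / p) * I ^ (1 / conj q) := by
          simp only [K₁, K₂]; ring
      _ = _ := by rw [e]
  have := le_rpow_of_le_mul_rpow hIt (by positivity) hfin
  rw [one_div_one_div] at this
  calc I ^ (1 / q) ≤ (((K₁ + K₂) * W ^ m * h ^ (1 / p)) ^ q) ^ (1 / q) := by gcongr
    _ = (K₁ + K₂) * W ^ m * h ^ (1 / p) := by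
        rw [← ENNReal.rpow_mul, mul_one_div_cancel hq0.ne', ENNReal.rpow_one]
    _ ≤ _ := by
        gcongr ?_ * _ * _
        exact le_self_add

end FiniteBound

/-! ### Weights on cubes -/

section Weights

/-- The measure `w dx`. -/
def wMeas (w : Rd d → ℝ) : Measure (Rd d) := volume.withDensity fun x => ENNReal.ofReal (w x)

lemma wMeas_apply (w : Rd d → ℝ) {A : Set (Rd d)} (hA : MeasurableSet A) :
    wMeas w A = ∫⁻ x in A, ENNReal.ofReal (w x) := withDensity_apply _ hA

lemma measure_rpow_le_wMeas {w : Rd d → ℝ} (hw0 : ∀ x, 0 < w x) (hw : Measurable w) {q : ℝ}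
    (hq : 1 < q) {A : Set (Rd d)} (hA : MeasurableSet A) :
    volume A ^ q ≤ wMeas w A * wMeas (fun x => w x ^ (-(conj q / q))) A ^ (q - 1) := by
  have hq0 : 0 < q := by linarith
  have hqc := holderConjugate_conj hq
  have hle := lintegral_mul_le_rpow (volume.restrict A)
    (f := fun x => ENNReal.ofReal (w x) ^ (1 / q))
    (g := fun x => ENNReal.ofReal (w x ^ (-(conj q / q))) ^ (1 / conj q))
    (by fun_prop) (by fun_prop) hqc
  have h1 : ∀ x, ENNReal.ofReal (w x) ^ (1 / q) *
      ENNReal.ofReal (w x ^ (-(conj q / q))) ^ (1 / conj q) = 1 := by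
    intro x
    have hqc0 := hqc.symm.pos.ne'
    rw [← ENNReal.ofReal_rpow_of_pos (hw0 x), ← ENNReal.rpow_mul,
      ← ENNReal.rpow_add _ _ (by simpa using hw0 x) ENNReal.ofReal_ne_top]
    have : 1 / q + -(conj q / q) * (1 / conj q) = 0 := by field_simp; ring
    rw [this, ENNReal.rpow_zero]
  simp only [h1, ← ENNReal.rpow_mul, one_div_mul_cancel hq0.ne',
    one_div_mul_cancel hqc.symm.pos.ne', ENNReal.rpow_one, lintegral_const, one_mul,
    Measure.restrict_apply_univ] at hle
  rw [← wMeas_apply w hA, ← wMeas_apply _ hA] at hle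
  have := ENNReal.rpow_le_rpow hle hq0.le
  rw [ENNReal.mul_rpow_of_nonneg _ _ hq0.le, ← ENNReal.rpow_mul, ← ENNReal.rpow_mul,
    one_div_mul_cancel hq0.ne', ENNReal.rpow_one] at this
  have e : 1 / conj q * q = q - 1 := by rw [conj]; field_simp
  rwa [e] at this

lemma Cube.carrier_eq (Q : Cube d) : Q.carrier = (MeasurableEquiv.toLp 2 (Fin d → ℝ)).symm ⁻¹'
    Set.pi univ fun i => Ico (Q.corner i) (Q.corner i + Q.side) := by
  ext x; simp [Cube.carrier]

lemma Cube.measurableSet_carrier (Q : Cube d) : MeasurableSet Q.carrier := by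
  rw [Q.carrier_eq]
  exact (MeasurableEquiv.measurable _) (MeasurableSet.univ_pi fun _ => measurableSet_Ico)

lemma Cube.volume_carrier (Q : Cube d) : volume Q.carrier = ENNReal.ofReal Q.vol := by
  rw [Q.carrier_eq, (EuclideanSpace.volume_preserving_symm_measurableEquiv_toLp
    (Fin d)).measure_preimage_equiv, Real.volume_pi_Ico]
  simp [Cube.vol, ENNReal.ofReal_pow Q.side_pos.le]

lemma Cube.vol_pos (Q : Cube d) : 0 < Q.vol := pow_pos Q.side_pos d

lemma Cube.nonempty_carrier (Q : Cube d) : Q.carrier.Nonempty :=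
  ⟨WithLp.toLp 2 Q.corner, fun i => ⟨le_rfl, by simpa using Q.side_pos⟩⟩

lemma Cube.isBounded_carrier (Q : Cube d) : Bornology.IsBounded Q.carrier := by
  have h : Bornology.IsBounded (Set.pi univ fun i => Ico (Q.corner i) (Q.corner i + Q.side)) :=
    Bornology.IsBounded.pi fun i => Metric.isBounded_Ico _ _
  rw [Q.carrier_eq]
  exact (PiLp.antilipschitzWith_ofLp 2 fun _ : Fin d => ℝ).isBounded_preimage h

lemma Cube.integrableOn (Q : Cube d) {w : Rd d → ℝ} (hw : LocallyIntegrable w volume) :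
    IntegrableOn w Q.carrier :=
  (hw.integrableOn_isCompact Q.isBounded_carrier.isCompact_closure).mono_set subset_closure

lemma wMeas_carrier (Q : Cube d) {w : Rd d → ℝ} (hw0 : ∀ x, 0 < w x)
    (hw : LocallyIntegrable w volume) : wMeas w Q.carrier = ENNReal.ofReal (intC Q w) := by
  rw [wMeas_apply _ Q.measurableSet_carrier, intC, ofReal_integral_eq_lintegral_ofReal
    (Q.integrableOn hw) (ae_of_all _ fun x => (hw0 x).le)]

lemma intC_nonneg (Q : Cube d) {w : Rd d → ℝ} (hw0 : ∀ x, 0 ≤ w x) : 0 ≤ intC Q w :=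
  integral_nonneg hw0

variable {w : Rd d → ℝ} {q : ℝ}

lemma wMeas_mul_le (hq : 1 < q) (hw : IsApOn univ q w) (Q : Cube d) :
    wMeas w Q.carrier * wMeas (fun x => w x ^ (-(conj q / q))) Q.carrier ^ (q - 1) ≤
      ApCharOn univ q w * volume Q.carrier ^ q := by
  obtain ⟨⟨hw0, -, hwl⟩, hσl, -⟩ := hw
  have hσ0 : ∀ x, 0 < w x ^ (-(conj q / q)) := fun x => Real.rpow_pos_of_pos (hw0 x) _
  have hq1 : 0 < q - 1 := by linarith
  have e : q / conj q = q - 1 := by rw [conj]; field_simp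
  have hv := Q.vol_pos
  have hle : ENNReal.ofReal (avg Q w * avg Q (fun x => w x ^ (-(conj q / q))) ^ (q - 1)) ≤
      ApCharOn univ q w := by
    rw [← e]
    exact le_iSup₂_of_le Q (mem_univ Q) le_rfl
  have ha : 0 ≤ intC Q w := intC_nonneg Q fun x => (hw0 x).le
  have hb : 0 ≤ intC Q fun x => w x ^ (-(conj q / q)) := intC_nonneg Q fun x => (hσ0 x).le
  refine le_trans (le_of_eq ?_) (mul_le_mul_left hle _)
  rw [wMeas_carrier Q hw0 hwl, wMeas_carrier Q hσ0 hσl, Q.volume_carrier,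
    ENNReal.ofReal_rpow_of_nonneg hb hq1.le, ENNReal.ofReal_rpow_of_pos hv,
    ← ENNReal.ofReal_mul ha, ← ENNReal.ofReal_mul (by rw [avg, avg]; positivity), avg, avg,
    Real.mul_rpow (by positivity) hb, Real.inv_rpow hv.le]
  congr 1
  have : Q.vol ^ q = Q.vol * Q.vol ^ (q - 1) := by
    rw [← Real.rpow_one_add' hv.le (by linarith)]; congr 1; ring
  rw [this]
  have := (Real.rpow_pos_of_pos hv (q - 1)).ne'
  field_simp

lemma one_le_ApCharOn (hq : 1 < q) (hw : IsApOn univ q w) : 1 ≤ ApCharOn univ q w := by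
  let Q : Cube d := ⟨0, 1, one_pos⟩
  have h := (measure_rpow_le_wMeas hw.1.1 hw.1.2.1 hq Q.measurableSet_carrier).trans
    (wMeas_mul_le hq hw Q)
  have hv : volume Q.carrier = 1 := by rw [Q.volume_carrier]; simp [Cube.vol, Q]
  simpa [hv] using h

lemma wMeas_ne_zero {w : Rd d → ℝ} (hw0 : ∀ x, 0 < w x) (hw : Measurable w) {A : Set (Rd d)}
    (hA : MeasurableSet A) (h : volume A ≠ 0) : wMeas w A ≠ 0 := by
  intro h0
  have := measure_rpow_le_wMeas hw0 hw one_lt_two hA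
  rw [h0, zero_mul, nonpos_iff_eq_zero] at this
  simp [h] at this

end Weights

section Dyadic

variable {D : DyadicLattice d}

lemma DyadicLattice.exists_carrier_subset (D : DyadicLattice d) (k : ℤ) (n : ℕ) :
    ∀ Q ∈ D.layer (k + n), ∃ R ∈ D.layer k, Q.carrier ⊆ R.carrier := by
  induction n with
  | zero => exact fun Q hQ => ⟨Q, by simpa using hQ, subset_rfl⟩
  | succ n ih =>
    intro Q hQ
    obtain ⟨R, hR, hQR⟩ := D.refines (k + n) Q (by rwa [add_assoc, ← Nat.cast_succ])
    obtain ⟨P, hP, hRP⟩ := ih R hR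
    exact ⟨P, hP, hQR.trans hRP⟩

lemma DyadicLattice.eq_or_disjoint (D : DyadicLattice d) {k : ℤ} {Q R : Cube d}
    (hQ : Q ∈ D.layer k) (hR : R ∈ D.layer k) : Q = R ∨ Disjoint Q.carrier R.carrier :=
  or_iff_not_imp_left.2 fun h => disjoint_iff_inter_eq_empty.2 (D.pairwiseDisjoint k Q hQ R hR h)

lemma DyadicLattice.subset_or_disjoint_of_le (D : DyadicLattice d) {k l : ℤ} (hkl : k ≤ l)
    {Q R : Cube d} (hQ : Q ∈ D.layer l) (hR : R ∈ D.layer k) :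
    Q.carrier ⊆ R.carrier ∨ Disjoint Q.carrier R.carrier := by
  obtain ⟨n, rfl⟩ := Int.le.dest hkl
  obtain ⟨P, hP, hQP⟩ := D.exists_carrier_subset k n Q hQ
  rcases D.eq_or_disjoint hP hR with rfl | h
  · exact Or.inl hQP
  · exact Or.inr (h.mono_left hQP)

lemma DyadicLattice.nested (D : DyadicLattice d) {Q R : Cube d} (hQ : Q ∈ D.cubes)
    (hR : R ∈ D.cubes) :
    Q.carrier ⊆ R.carrier ∨ R.carrier ⊆ Q.carrier ∨ Disjoint Q.carrier R.carrier := by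
  obtain ⟨k, hk⟩ := hQ
  obtain ⟨l, hl⟩ := hR
  rcases le_total k l with h | h
  · rcases D.subset_or_disjoint_of_le h hl hk with h' | h'
    · exact Or.inr (Or.inl h')
    · exact Or.inr (Or.inr h'.symm)
  · rcases D.subset_or_disjoint_of_le h hk hl with h' | h'
    · exact Or.inl h'
    · exact Or.inr (Or.inr h')

lemma DyadicLattice.injOn_carrier (hd : 0 < d) (D : DyadicLattice d) :
    InjOn Cube.carrier D.cubes := by
  rintro Q ⟨k, hk⟩ R ⟨l, hl⟩ h
  have hv : Q.vol = R.vol := by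
    have := congrArg volume h
    rwa [Q.volume_carrier, R.volume_carrier,
      ENNReal.ofReal_eq_ofReal_iff Q.vol_pos.le R.vol_pos.le] at this
  have hside : Q.side = R.side :=
    (pow_left_inj₀ Q.side_pos.le R.side_pos.le hd.ne').1 hv
  rw [D.side_eq k Q hk, D.side_eq l R hl] at hside
  obtain rfl : k = l := by
    have := zpow_right_injective₀ (by norm_num : (0 : ℝ) < 2) (by norm_num) hside
    omega
  refine (D.eq_or_disjoint hk hl).resolve_right fun hdisj => ?_
  rw [h, disjoint_self] at hdisj
  exact R.nonempty_carrier.ne_empty hdisj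

end Dyadic

section Terms

variable {w f : Rd d → ℝ} {p q s : ℝ}

/-- The function `|f| σ^{-1/s}`, where `σ = w^{-q'/q}`. -/
def dualFun (q s : ℝ) (w f : Rd d → ℝ) (x : Rd d) : ℝ≥0∞ :=
  ENNReal.ofReal |f x| * ENNReal.ofReal (w x ^ (-(conj q / q))) ^ (-(1 / s))

lemma measurable_dualFun (hw : Measurable w) (hf : Measurable f) :
    Measurable (dualFun q s w f) := by
  unfold dualFun; fun_prop

lemma setLIntegral_dualFun_rpow (hw0 : ∀ x, 0 < w x) (hw : Measurable w) (hf : Measurable f)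
    {t : ℝ} (ht : 0 ≤ t) {A : Set (Rd d)} (hA : MeasurableSet A) :
    ∫⁻ x in A, dualFun q s w f x ^ t ∂(wMeas fun x => w x ^ (-(conj q / q))) =
      ∫⁻ x in A, ENNReal.ofReal (|f x| ^ t * (w x ^ (-(conj q / q))) ^ (1 - t / s)) := by
  rw [wMeas, setLIntegral_withDensity_eq_setLIntegral_mul _ (by fun_prop)
    ((measurable_dualFun hw hf).pow_const t) hA]
  refine lintegral_congr fun x => ?_
  have hpos : 0 < w x ^ (-(conj q / q)) := Real.rpow_pos_of_pos (hw0 x) _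
  have hne : ENNReal.ofReal (w x ^ (-(conj q / q))) ≠ 0 := by simpa using hpos
  rw [ENNReal.ofReal_mul (by positivity), ← ENNReal.ofReal_rpow_of_nonneg (abs_nonneg _) ht,
    ← ENNReal.ofReal_rpow_of_pos hpos, Pi.mul_apply, dualFun, ENNReal.mul_rpow_of_nonneg _ _ ht,
    ← ENNReal.rpow_mul, sub_eq_add_neg, ENNReal.rpow_add _ _ hne ENNReal.ofReal_ne_top,
    ENNReal.rpow_one]
  have e : -(1 / s) * t = -(t / s) := by ring
  rw [e]
  ring

lemma lintegral_dualFun_rpow (hw0 : ∀ x, 0 < w x) (hw : Measurable w) (hf : Measurable f)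
    (hp : 0 < p) (hq : 1 < q) (hs : 1 / s = 1 + (1 / p - 1 / q)) :
    ∫⁻ x, dualFun q s w f x ^ p ∂(wMeas fun x => w x ^ (-(conj q / q))) =
      ∫⁻ x, ENNReal.ofReal (|f x| ^ p * (fun x => w x ^ (p / q)) x) := by
  have h := setLIntegral_dualFun_rpow (q := q) (s := s) hw0 hw hf hp.le MeasurableSet.univ
  simp only [Measure.restrict_univ] at h
  rw [h]
  refine lintegral_congr fun x => ?_
  have hq1 : 0 < q - 1 := by linarith
  have e : -(conj q / q) * (1 - p / s) = p / q := by
    rw [div_eq_mul_one_div p s, hs, conj]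
    field_simp
    ring
  rw [← Real.rpow_mul (hw0 x).le, e]

lemma ofReal_term_le (hw0 : ∀ x, 0 < w x) (hw : Measurable w) (hf : Measurable f) {e : ℝ}
    (he : 0 ≤ e) (hs : 1 / s = 1 + e) (Q : Cube d)
    (hσ0 : wMeas (fun x => w x ^ (-(conj q / q))) Q.carrier ≠ 0)
    (hσ : wMeas (fun x => w x ^ (-(conj q / q))) Q.carrier ≠ ⊤) :
    ENNReal.ofReal ((Q.vol ^ (-s) * intC Q fun y => |f y| ^ s) ^ (1 / s)) ≤
      fracCoef volume (wMeas fun x => w x ^ (-(conj q / q)))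
          (wMeas fun x => w x ^ (-(conj q / q))) e Q.carrier *
        wav (wMeas fun x => w x ^ (-(conj q / q))) (dualFun q s w f) Q.carrier := by
  set σ := wMeas fun x => w x ^ (-(conj q / q))
  have hs0 : 0 < s := one_div_pos.1 (by rw [hs]; linarith)
  have hs1 : s ≤ 1 := by
    have : 1 ≤ 1 / s := by rw [hs]; linarith
    rwa [le_div_iff₀ hs0, one_mul] at this
  have hint : ENNReal.ofReal (intC Q fun y => |f y| ^ s) ≤
      (∫⁻ x in Q.carrier, dualFun q s w f x ∂σ) ^ s * σ Q.carrier ^ (1 - s) := by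
    have h1 : ENNReal.ofReal (intC Q fun y => |f y| ^ s) ≤
        ∫⁻ x in Q.carrier, ENNReal.ofReal (|f x| ^ s) := by
      by_cases hi : IntegrableOn (fun y => |f y| ^ s) Q.carrier
      · rw [intC, ofReal_integral_eq_lintegral_ofReal hi (ae_of_all _ fun x => by positivity)]
      · rw [intC, integral_undef hi]; simp
    have h2 := setLIntegral_dualFun_rpow (q := q) (s := s) hw0 hw hf hs0.le
      Q.measurableSet_carrier
    simp only [div_self hs0.ne', sub_self, Real.rpow_zero, mul_one] at h2
    rw [← h2] at h1
    have h3 := ENNReal.lintegral_mul_norm_pow_le (μ := σ.restrict Q.carrier)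
      (measurable_dualFun (q := q) (s := s) hw hf).aemeasurable
      (measurable_const (a := (1 : ℝ≥0∞))).aemeasurable hs0.le (sub_nonneg.2 hs1) (by ring)
    simp only [ENNReal.one_rpow, mul_one, lintegral_const, one_mul,
      Measure.restrict_apply_univ] at h3
    exact h1.trans h3
  have hv := Q.vol_pos
  have hI : 0 ≤ intC Q fun y => |f y| ^ s := intC_nonneg Q fun x => by positivity
  have e1 : (1 - s) * (1 / s) = e := by rw [hs]; rw [div_eq_iff hs0.ne'] at hs; linarith
  calc ENNReal.ofReal ((Q.vol ^ (-s) * intC Q fun y => |f y| ^ s) ^ (1 / s))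
      = (volume Q.carrier)⁻¹ * ENNReal.ofReal (intC Q fun y => |f y| ^ s) ^ (1 / s) := by
        rw [Real.mul_rpow (by positivity) hI, ← Real.rpow_mul hv.le, neg_mul,
          mul_one_div_cancel hs0.ne', Real.rpow_neg_one, ENNReal.ofReal_mul (by positivity),
          ENNReal.ofReal_inv_of_pos hv, Q.volume_carrier,
          ENNReal.ofReal_rpow_of_nonneg hI (by positivity)]
    _ ≤ (volume Q.carrier)⁻¹ * ((∫⁻ x in Q.carrier, dualFun q s w f x ∂σ) ^ s *
          σ Q.carrier ^ (1 - s)) ^ (1 / s) := by gcongr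
    _ = (volume Q.carrier)⁻¹ * ((∫⁻ x in Q.carrier, dualFun q s w f x ∂σ) *
          σ Q.carrier ^ e) := by
        rw [ENNReal.mul_rpow_of_nonneg _ _ (by positivity), ← ENNReal.rpow_mul,
          ← ENNReal.rpow_mul, mul_one_div_cancel hs0.ne', ENNReal.rpow_one, e1]
    _ = (volume Q.carrier)⁻¹ * (wav σ (dualFun q s w f) Q.carrier * σ Q.carrier *
          σ Q.carrier ^ e) := by rw [wav, ENNReal.div_mul_cancel hσ0 hσ]
    _ = _ := by rw [fracCoef, ENNReal.div_eq_inv_mul]; ring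

end Terms

section Sparse

variable {w f : Rd d → ℝ} {p q s γ : ℝ} {D : DyadicLattice d} {S : Set (Cube d)}

lemma SparseFamily.le_volume {E : Cube d → Set (Rd d)} {Q : Cube d} (hγ : 0 < γ)
    (hE : E Q ⊆ Q.carrier) (h : γ * wInt Q (fun _ => 1) ≤ ∫ _ in E Q, (1 : ℝ)) :
    ENNReal.ofReal γ * volume Q.carrier ≤ volume (E Q) := by
  have hfin : volume Q.carrier ≠ ⊤ := by simp [Q.volume_carrier]
  have hfinE : volume (E Q) ≠ ⊤ := ne_top_of_le_ne_top hfin (measure_mono hE)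
  simp only [wInt, intC, setIntegral_const, smul_eq_mul, mul_one] at h
  have := ENNReal.ofReal_le_ofReal h
  rwa [ENNReal.ofReal_mul hγ.le, ofReal_measureReal hfin, ofReal_measureReal hfinE] at this

instance : Nonempty (Cube d) := ⟨⟨0, 1, one_pos⟩⟩

open Classical in
lemma dualWeights_image (hd : 0 < d) (hq : 1 < q) (hγ : 0 < γ) (hw : IsApOn univ q w)
    (hS : S ⊆ D.cubes) {E : Cube d → Set (Rd d)}
    (hE : ∀ Q ∈ S, E Q ⊆ Q.carrier ∧ MeasurableSet (E Q) ∧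
      γ * wInt Q (fun _ => 1) ≤ ∫ _ in E Q, (1 : ℝ))
    (hdisj : S.Pairwise fun Q R => Disjoint (E Q) (E R)) {F : Finset (Cube d)} (hF : ↑F ⊆ S) :
    DualWeights (F.image Cube.carrier) (fun A => E (Function.invFunOn Cube.carrier S A)) volume γ q
      (wMeas fun x => w x ^ (-(conj q / q))) (wMeas w) (ApCharOn univ q w) := by
  have hinv : ∀ Q ∈ F, Function.invFunOn Cube.carrier S Q.carrier = Q := fun Q hQ =>
    ((D.injOn_carrier hd).mono hS).leftInvOn_invFunOn (hF hQ)
  have hσ0 : ∀ x, 0 < w x ^ (-(conj q / q)) := fun x => Real.rpow_pos_of_pos (hw.1.1 x) _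
  have hσm : Measurable fun x => w x ^ (-(conj q / q)) := hw.1.2.1.pow_const _
  have hN : ∀ Q : Cube d, volume Q.carrier ≠ 0 := fun Q => by
    simpa [Q.volume_carrier] using Q.vol_pos
  refine ⟨⟨?_, ?_, ?_, ?_, ?_, ?_, ?_, ?_⟩, ?_, ?_, ?_, ?_, ?_, one_le_ApCharOn hq hw, hw.2.2.ne,
    ?_, ?_⟩
  · exact Finset.forall_mem_image.2 fun Q _ => Q.measurableSet_carrier
  · exact Finset.forall_mem_image.2 fun Q hQ => Finset.forall_mem_image.2 fun R hR =>
      D.nested (hS (hF hQ)) (hS (hF hR))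
  · exact Finset.forall_mem_image.2 fun Q _ => Q.nonempty_carrier
  · exact Finset.forall_mem_image.2 fun Q hQ => by rw [hinv Q hQ]; exact (hE Q (hF hQ)).1
  · exact Finset.forall_mem_image.2 fun Q hQ => by rw [hinv Q hQ]; exact (hE Q (hF hQ)).2.1
  · intro A hA B hB hAB
    obtain ⟨Q, hQ, rfl⟩ := Finset.mem_image.1 (Finset.mem_coe.1 hA)
    obtain ⟨R, hR, rfl⟩ := Finset.mem_image.1 (Finset.mem_coe.1 hB)
    simp only [Function.onFun, hinv Q hQ, hinv R hR]
    exact hdisj (hF hQ) (hF hR) fun h => hAB (h ▸ rfl)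
  · exact Finset.forall_mem_image.2 fun Q _ => by simp [Q.volume_carrier]
  · exact Finset.forall_mem_image.2 fun Q hQ => by
      rw [hinv Q hQ]
      exact SparseFamily.le_volume hγ (hE Q (hF hQ)).1 (hE Q (hF hQ)).2.2
  · exact Finset.forall_mem_image.2 fun Q _ => hN Q
  · exact Finset.forall_mem_image.2 fun Q _ =>
      wMeas_ne_zero hσ0 hσm Q.measurableSet_carrier (hN Q)
  · exact Finset.forall_mem_image.2 fun Q _ => by simp [wMeas_carrier Q hσ0 hw.2.1]
  · exact Finset.forall_mem_image.2 fun Q _ =>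
      wMeas_ne_zero hw.1.1 hw.1.2.1 Q.measurableSet_carrier (hN Q)
  · exact Finset.forall_mem_image.2 fun Q _ => by simp [wMeas_carrier Q hw.1.1 hw.1.2.2]
  · exact Finset.forall_mem_image.2 fun Q _ => wMeas_mul_le hq hw Q
  · exact Finset.forall_mem_image.2 fun Q hQ => by
      rw [hinv Q hQ]
      exact measure_rpow_le_wMeas hw.1.1 hw.1.2.1 hq (hE Q (hF hQ)).2.1

lemma SparseFamily.countable (hγ : 0 < γ) (hS : SparseFamily γ (fun _ => 1) S) :
    Countable S := by
  obtain ⟨E, hE, hdisj⟩ := hS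
  have h := Measure.countable_meas_pos_of_disjoint_iUnion (μ := volume)
    (As := fun Q : S => E Q) (fun Q => (hE Q Q.2).2.1)
    fun Q R hQR => hdisj Q.2 R.2 (Subtype.coe_injective.ne hQR)
  rw [← countable_univ_iff]
  refine h.mono fun Q _ => ?_
  refine lt_of_lt_of_le ?_ (SparseFamily.le_volume hγ (hE Q Q.2).1 (hE Q Q.2).2.2)
  exact ENNReal.mul_pos (by simpa using hγ) (by simpa [Cube.volume_carrier] using Q.1.vol_pos)

lemma lintegral_tsum_rpow {α ι : Type*} [MeasurableSpace α] [Countable ι] {μ : Measure α}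
    {F : ι → α → ℝ≥0∞} (hF : ∀ i, Measurable (F i)) {q : ℝ} (hq : 0 < q) :
    ∫⁻ x, (∑' i, F i x) ^ q ∂μ = ⨆ T : Finset ι, ∫⁻ x, (∑ i ∈ T, F i x) ^ q ∂μ := by
  rw [← lintegral_iSup_directed]
  · refine lintegral_congr fun x => ?_
    rw [ENNReal.tsum_eq_iSup_sum]
    exact (ENNReal.orderIsoRpow q hq).map_iSup _
  · exact fun T => ((Finset.measurable_fun_sum _ fun i _ => hF i).pow_const q).aemeasurable
  · refine Monotone.directed_le fun T U hTU x => ?_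
    exact ENNReal.rpow_le_rpow (Finset.sum_le_sum_of_subset hTU) hq.le

end Sparse
/-- **Lemma 3.2** (weighted bound for the sparse operator with exponent `s`, after
Fackler–Hytönen). For `1 < p ≤ q < ∞`, `1/s = 1/p + 1/q'`, `w ∈ A_q` and a `γ`-sparse
collection `S` of dyadic cubes, the operator
`f ↦ Σ_{Q∈S} (|Q|^{−s} ∫_Q |f|^s)^{1/s} 1_Q` is bounded from `L^p(w^{p/q})` to `L^q(w)`
with norm `≲ [w]_{A_q}^{max(1/p'+1/q, 1/(q−1))}`. -/
theorem stmt4 (d : ℕ) (hd : 0 < d) (p q s γ : ℝ) (hp : 1 < p) (hpq : p ≤ q)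
    (hs : 1 / s = 1 / p + 1 / conj q) (hγ : 0 < γ) (hγ1 : γ < 1) :
    ∃ C : ℝ, 0 < C ∧
      ∀ w : Rd d → ℝ, IsApOn Set.univ q w →
        ∀ (D : DyadicLattice d) (S : Set (Cube d)), S ⊆ D.cubes →
          SparseFamily γ (fun _ => 1) S →
          ∀ f : Rd d → ℝ, Measurable f →
            wnormE q w (sparseOpPow S s f) ≤
              ENNReal.ofReal C * ApCharOn Set.univ q w ^ max (1 / conj p + 1 / q) (1 / (q - 1)) *
                wnorm p (fun x => w x ^ (p / q)) f := by
  obtain ⟨K, hK, hbound⟩ := exists_sparse_bound hγ hγ1 hp hpq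
  refine ⟨K.toReal + 1, by positivity, fun w hw D S hS hsp f hf => ?_⟩
  classical
  have hp0 : 0 < p := by linarith
  have hq : 1 < q := by linarith
  have hq0 : 0 < q := by linarith
  have he : 0 ≤ 1 / p - 1 / q := sub_nonneg.2 (one_div_le_one_div_of_le hp0 hpq)
  have hs' : 1 / s = 1 + (1 / p - 1 / q) := by
    have := (holderConjugate_conj hq).inv_add_inv_eq_one
    rw [hs, one_div, one_div, one_div]
    linarith
  have hcount := hsp.countable hγ
  obtain ⟨E, hE, hdisj⟩ := hsp
  set m := max (1 / conj p + 1 / q) (1 / (q - 1))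
  set B := K * ApCharOn univ q w ^ m * wnorm p (fun x => w x ^ (p / q)) f
  have hfin : ∀ T : Finset S, ∫⁻ x, (∑ Q ∈ T, (Q : Cube d).carrier.indicator (fun _ =>
      ENNReal.ofReal (((Q : Cube d).vol ^ (-s) * intC (Q : Cube d) fun y => |f y| ^ s) ^ (1 / s)))
      x) ^ q ∂(wMeas w) ≤ B ^ q := by
    intro T
    have hTS : ↑(T.map (Function.Embedding.subtype _)) ⊆ S := by simp
    have hDW := dualWeights_image hd hq hγ hw hS hE hdisj hTS
    have h := hbound hDW (measurable_dualFun (q := q) (s := s) hw.1.2.1 hf)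
    rw [lintegral_dualFun_rpow hw.1.1 hw.1.2.1 hf hp0 hq hs'] at h
    have h' := ENNReal.rpow_le_rpow h hq0.le
    rw [← ENNReal.rpow_mul, one_div_mul_cancel hq0.ne', ENNReal.rpow_one] at h'
    refine le_trans (lintegral_mono fun x => ?_) h'
    gcongr
    rw [famSum, Finset.sum_image (((D.injOn_carrier hd).mono hS).mono hTS), Finset.sum_map]
    refine Finset.sum_le_sum fun Q hQ => indicator_le_indicator ?_
    have hQT : (Q : Cube d).carrier ∈
        (T.map (Function.Embedding.subtype _)).image Cube.carrier :=
      Finset.mem_image_of_mem _ (Finset.mem_map_of_mem _ hQ)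
    exact ofReal_term_le hw.1.1 hw.1.2.1 hf he hs' Q (hDW.σ_pos _ hQT) (hDW.σ_fin _ hQT)
  have hmeas : ∀ Q : S, Measurable ((Q : Cube d).carrier.indicator (fun _ =>
      ENNReal.ofReal (((Q : Cube d).vol ^ (-s) *
        intC (Q : Cube d) fun y => |f y| ^ s) ^ (1 / s)))) :=
    fun Q => measurable_const.indicator (Q : Cube d).measurableSet_carrier
  have htot : ∫⁻ x, sparseOpPow S s f x ^ q ∂(wMeas w) ≤ B ^ q := by
    simp only [sparseOpPow]
    rw [lintegral_tsum_rpow hmeas hq0]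
    exact iSup_le hfin
  have hnorm : wnormE q w (sparseOpPow S s f) =
      (∫⁻ x, sparseOpPow S s f x ^ q ∂(wMeas w)) ^ (1 / q) := by
    rw [wnormE, wMeas, lintegral_withDensity_eq_lintegral_mul _ hw.1.2.1.ennreal_ofReal]
    · simp only [Pi.mul_apply, mul_comm]
    · exact (Measurable.tsum hmeas).pow_const q
  calc wnormE q w (sparseOpPow S s f) ≤ (B ^ q) ^ (1 / q) := by
        rw [hnorm]; gcongr
    _ = B := by rw [← ENNReal.rpow_mul, mul_one_div_cancel hq0.ne', ENNReal.rpow_one]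
    _ ≤ _ := by
        simp only [B]
        gcongr
        calc K = ENNReal.ofReal K.toReal := (ENNReal.ofReal_toReal hK).symm
          _ ≤ _ := ENNReal.ofReal_le_ofReal (by linarith)
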